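/- arXiv:1008.4113 — 4 statements merged into one kernel-verified Lean document; each statement's English description precedes it below -/
import Mathlib

section
/- Zero-density convergence from a liminf bound and Cesàro-type convergence: let (f_n) be a sequence of real numbers, A ∈ ℝ, β ∈ (0,1), and ℓ slowly varying. Assume (a) liminf_{n→∞} ℓ(n) n^{1−β} f_n ≥ A, and (b) lim_{n→∞} ℓ(n) n^{−β} Σ_{j=1}^{n} f_j = β^{−1} A. Then there exists a set E ⊆ ℕ of density zero (i.e. (1/n)·#{j ∈ E : 1 ≤ j ≤ n} → 0) such that lim_{n→∞, n∉E} ℓ(n) n^{1−β} f_n = A. In particular, liminf_{n→∞} ℓ(n) n^{1−β} f_n = A. -/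
open MeasureTheory Filter Topology

/-- `l` is slowly varying: measurable, bounded above and below by positive constants on
each compact subset of `(0,∞)`, and `l (λ x)/ l x → 1` as `x → ∞` for every `λ > 0`. -/
def SlowlyVarying (l : ℝ → ℝ) : Prop :=
  Measurable l ∧
  (∀ K : Set ℝ, IsCompact K → K ⊆ Set.Ioi 0 →
    ∃ c C : ℝ, 0 < c ∧ ∀ x ∈ K, c ≤ l x ∧ l x ≤ C) ∧
  ∀ lam : ℝ, 0 < lam → Tendsto (fun x => l (lam * x) / l x) atTop (𝓝 1)

theorem uct_add (h : ℝ → ℝ) (hm : Measurable h)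
    (hlim : ∀ u : ℝ, Tendsto (fun x => h (x + u) - h x) atTop (𝓝 0)) (ε : ℝ) (hε : 0 < ε) :
    ∀ᶠ x in atTop, ∀ u ∈ Set.Icc (0:ℝ) 1, |h (x + u) - h x| < ε := by
  set B : ℝ → Set ℝ := fun x => {u | ε / 2 ≤ |h (x + u) - h x|} with hB
  have hBm : ∀ x, MeasurableSet (B x) := by
    intro x
    apply measurableSet_le measurable_const
    exact ((hm.comp (measurable_const_add x)).sub measurable_const).abs
  have ht : Tendsto (fun x => (volume.restrict (Set.Icc (0:ℝ) 2)) (B x)) atTop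
      (𝓝 ((volume.restrict (Set.Icc (0:ℝ) 2)) ∅)) := by
    apply tendsto_measure_of_tendsto_indicator_of_isFiniteMeasure atTop _ hBm
    intro u
    have := (hlim u).abs
    rw [abs_zero] at this
    filter_upwards [this.eventually_lt_const (half_pos hε)] with x hx
    simp only [hB, Set.mem_ofPred_eq, Set.mem_empty_iff_false, iff_false, not_le]
    exact hx
  rw [measure_empty] at ht
  have h4 : (0 : ENNReal) < ENNReal.ofReal (1/4) := by simp
  obtain ⟨X, hX⟩ := eventually_atTop.1 (ht.eventually_lt_const h4)
  filter_upwards [eventually_ge_atTop X] with x hx u hu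
  have h1 := hX x hx
  have h2 := hX (x + u) (by linarith [hu.1])
  rw [Measure.restrict_apply (hBm _)] at h1 h2
  by_contra hcon
  have hsub : Set.Icc (1:ℝ) 2 ⊆ (B x ∩ Set.Icc 0 2) ∪ (fun v => v + (-u)) ⁻¹' (B (x+u) ∩ Set.Icc 0 2) := by
    intro v hv
    by_contra hn
    rw [Set.mem_union, not_or] at hn
    obtain ⟨n1, n2⟩ := hn
    have a1 : |h (x + v) - h x| < ε / 2 := by
      by_contra hc
      exact n1 ⟨not_lt.1 hc, by linarith [hv.1], hv.2⟩
    have a2 : |h (x + v) - h (x + u)| < ε / 2 := by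
      by_contra hc
      refine n2 ⟨?_, ?_, ?_⟩
      · have : x + u + (v + -u) = x + v := by ring
        simp only [hB, Set.mem_ofPred_eq, this]
        exact not_lt.1 hc
      · linarith [hv.1, hu.2]
      · linarith [hv.2, hu.1]
    apply hcon
    rw [abs_lt] at *
    constructor <;> linarith [a1.1, a1.2, a2.1, a2.2]
  have h3 := (measure_mono hsub).trans (measure_union_le (μ := volume) _ _)
  rw [measure_preimage_add_right, Real.volume_Icc] at h3
  have h5 := h3.trans (add_le_add h1.le h2.le)
  rw [← ENNReal.ofReal_add (by norm_num) (by norm_num), ENNReal.ofReal_le_ofReal_iff (by norm_num)] at h5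
  norm_num at h5

theorem sv_pos {l : ℝ → ℝ} (hl : SlowlyVarying l) {x : ℝ} (hx : 0 < x) : 0 < l x := by
  obtain ⟨c, C, hc, h⟩ := hl.2.1 {x} isCompact_singleton (by simpa using hx)
  exact hc.trans_le (h x rfl).1

theorem sv_unif {l : ℝ → ℝ} (hl : SlowlyVarying l) (ε : ℝ) (hε : 0 < ε) :
    ∀ᶠ m : ℕ in atTop, ∀ j : ℕ, m ≤ j → j ≤ 2 * m → |l m / l j - 1| < ε := by
  have hcont : Tendsto Real.exp (𝓝 0) (𝓝 1) := by
    simpa using Real.continuous_exp.tendsto 0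
  obtain ⟨δ, hδ, hδ'⟩ := Metric.tendsto_nhds_nhds.1 hcont ε hε
  have key := uct_add (fun x => Real.log (l (Real.exp x)))
    (Real.measurable_log.comp (hl.1.comp Real.measurable_exp)) (by
      intro u
      have h1 := (hl.2.2 (Real.exp u) (Real.exp_pos u)).comp Real.tendsto_exp_atTop
      have h2 := h1.log one_ne_zero
      rw [Real.log_one] at h2
      refine h2.congr fun x => ?_
      simp only [Function.comp]
      rw [← Real.exp_add, Real.log_div (sv_pos hl (Real.exp_pos _)).ne'
        (sv_pos hl (Real.exp_pos _)).ne', add_comm u x]) δ hδ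
  have hlog : Tendsto (fun m : ℕ => Real.log (m:ℝ)) atTop atTop :=
    Real.tendsto_log_atTop.comp tendsto_natCast_atTop_atTop
  filter_upwards [hlog.eventually key, eventually_ge_atTop 1] with m hm hm1 j hj1 hj2
  have hm0 : (0:ℝ) < m := by exact_mod_cast hm1
  have hj0 : (0:ℝ) < j := by exact_mod_cast (hm1.trans hj1)
  have hjm : (m:ℝ) ≤ j := by exact_mod_cast hj1
  have hjm2 : (j:ℝ) ≤ 2 * m := by exact_mod_cast hj2
  have := hm (Real.log (j / m)) ⟨Real.log_nonneg (by rw [le_div_iff₀ hm0]; linarith), by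
    have h1 : Real.log ((j:ℝ)/m) ≤ (j:ℝ)/m - 1 := Real.log_le_sub_one_of_pos (by positivity)
    have h2 : (j:ℝ)/m ≤ 2 := by rw [div_le_iff₀ hm0]; linarith
    linarith⟩
  rw [Real.log_div hj0.ne' hm0.ne'] at this
  simp only [add_sub_cancel] at this
  rw [Real.exp_log hj0, Real.exp_log hm0, abs_sub_comm, ← Real.log_div (sv_pos hl hm0).ne'
        (sv_pos hl hj0).ne'] at this
  have h3 := hδ' (x := Real.log (l m / l j)) (by simpa [Real.dist_eq] using this)
  rw [Real.exp_log (div_pos (sv_pos hl hm0) (sv_pos hl hj0))] at h3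
  simpa [Real.dist_eq] using h3

/- power sums -/
theorem pow_step {β : ℝ} (h0 : 0 < β) (h1 : β < 1) {x y : ℝ} (hx : 0 < x) (hy : 0 ≤ y) :
    y ^ β ≤ x ^ β + β * x ^ (β - 1) * (y - x) := by
  have hb := rpow_one_add_le_one_add_mul_self (s := (y - x)/x) (p := β)
    (by rw [le_div_iff₀ hx]; linarith) h0.le h1.le
  have e1 : 1 + (y - x)/x = y / x := by field_simp; ring
  rw [e1, Real.div_rpow hy hx.le, div_le_iff₀ (Real.rpow_pos_of_pos hx β)] at hb
  have e2 : x ^ (β - 1) = x ^ β / x := by rw [Real.rpow_sub hx, Real.rpow_one]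
  rw [e2]
  calc _ ≤ _ := hb
    _ = _ := by field_simp

theorem sum_upper {β : ℝ} (h0 : 0 < β) (h1 : β < 1) (m k : ℕ) :
    β * ∑ j ∈ Finset.Ioc m (m + k), (j:ℝ) ^ (β - 1) ≤ ((m + k : ℕ) : ℝ) ^ β - (m:ℝ) ^ β := by
  induction k with
  | zero => simp
  | succ k ih =>
    rw [← add_assoc, ← Finset.insert_Ioc_right_eq_Ioc_add_one (by omega), Finset.sum_insert (by simp), mul_add]
    have := pow_step h0 h1 (x := ((m + k + 1 : ℕ):ℝ)) (y := ((m + k : ℕ):ℝ)) (by positivity) (by positivity)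
    push_cast at *
    linarith

theorem sum_lower {β : ℝ} (h0 : 0 < β) (h1 : β < 1) (m k : ℕ) :
    ((m + k : ℕ) + 1 : ℝ) ^ β - (m + 1:ℝ) ^ β ≤ β * ∑ j ∈ Finset.Ioc m (m + k), (j:ℝ) ^ (β - 1) := by
  induction k with
  | zero => simp
  | succ k ih =>
    rw [← add_assoc, ← Finset.insert_Ioc_right_eq_Ioc_add_one (by omega), Finset.sum_insert (by simp), mul_add]
    have := pow_step h0 h1 (x := ((m + k + 1 : ℕ):ℝ)) (y := ((m + k + 1 : ℕ):ℝ) + 1) (by positivity) (by positivity)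
    push_cast at *
    linarith

theorem R_tendsto {β : ℝ} (h0 : 0 < β) (h1 : β < 1) :
    Tendsto (fun m : ℕ => ∑ j ∈ Finset.Ioc m (2 * m), (m:ℝ) ^ (-β) * (j:ℝ) ^ (β - 1)) atTop
      (𝓝 (β⁻¹ * (2 ^ β - 1))) := by
  have hlow : Tendsto (fun m : ℕ => β⁻¹ * ((2 + 1 / (m:ℝ)) ^ β - (1 + 1 / (m:ℝ)) ^ β)) atTop
      (𝓝 (β⁻¹ * (2 ^ β - 1))) := by
    have hz : Tendsto (fun m : ℕ => 1 / (m:ℝ)) atTop (𝓝 0) := tendsto_one_div_atTop_nhds_zero_nat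
    have e1 := (hz.const_add 2).rpow_const (p := β) (Or.inr h0.le)
    have e2 := (hz.const_add 1).rpow_const (p := β) (Or.inr h0.le)
    simpa using (e1.sub e2).const_mul β⁻¹
  refine tendsto_of_tendsto_of_tendsto_of_le_of_le' hlow tendsto_const_nhds ?_ ?_
  · filter_upwards [eventually_ge_atTop 1] with m hm
    have hm0 : (0:ℝ) < m := by exact_mod_cast hm
    have := sum_lower h0 h1 m m
    rw [← two_mul] at this
    have e1 : (2 + 1 / (m:ℝ)) = (((2 * m : ℕ):ℝ) + 1) / m := by push_cast; field_simp
    have e2 : (1 + 1 / (m:ℝ)) = ((m:ℝ) + 1) / m := by field_simp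
    rw [e1, e2, Real.div_rpow (by positivity) hm0.le, Real.div_rpow (by positivity) hm0.le,
      ← Finset.mul_sum, inv_mul_le_iff₀ h0, Real.rpow_neg hm0.le]
    have hp := Real.rpow_pos_of_pos hm0 β
    rw [← sub_div, div_le_iff₀ hp]
    calc _ ≤ _ := this
      _ = _ := by field_simp
  · filter_upwards [eventually_ge_atTop 1] with m hm
    have hm0 : (0:ℝ) < m := by exact_mod_cast hm
    have := sum_upper h0 h1 m m
    rw [← two_mul] at this
    have hp := Real.rpow_pos_of_pos hm0 β
    push_cast at this
    rw [Real.mul_rpow (by norm_num) hm0.le] at this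
    rw [← Finset.mul_sum, le_inv_mul_iff₀ h0, Real.rpow_neg hm0.le]
    calc _ = (β * ∑ j ∈ Finset.Ioc m (2 * m), (j:ℝ) ^ (β - 1)) / (m:ℝ)^β := by field_simp
      _ ≤ _ := by rw [div_le_iff₀ hp]; linarith

theorem W_tendsto {β : ℝ} (h0 : 0 < β) (h1 : β < 1) {l : ℝ → ℝ} (hl : SlowlyVarying l) :
    Tendsto (fun m : ℕ => ∑ j ∈ Finset.Ioc m (2 * m), l m / l j * ((m:ℝ) ^ (-β) * (j:ℝ) ^ (β - 1))) atTop
      (𝓝 (β⁻¹ * (2 ^ β - 1))) := by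
  have hR := R_tendsto h0 h1
  suffices hs : Tendsto (fun m : ℕ => ∑ j ∈ Finset.Ioc m (2 * m), l m / l j * ((m:ℝ) ^ (-β) * (j:ℝ) ^ (β - 1))
      - ∑ j ∈ Finset.Ioc m (2 * m), (m:ℝ) ^ (-β) * (j:ℝ) ^ (β - 1)) atTop (𝓝 0) by
    simpa using hs.add hR
  set L := β⁻¹ * ((2:ℝ) ^ β - 1) with hL
  have hLp : 0 ≤ L := by
    have : (1:ℝ) ≤ 2 ^ β := Real.one_le_rpow (by norm_num) h0.le
    have := inv_pos.2 h0
    apply mul_nonneg this.le; linarith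
  rw [Metric.tendsto_nhds]
  intro ε hε
  filter_upwards [sv_unif hl (ε / (L + 1) / 2) (by positivity),
    hR.eventually_lt_const (lt_add_one L)] with m hm hm2
  rw [Real.dist_eq, sub_zero, ← Finset.sum_sub_distrib]
  calc _ ≤ ∑ j ∈ Finset.Ioc m (2 * m), (ε / (L + 1) / 2) * ((m:ℝ) ^ (-β) * (j:ℝ) ^ (β - 1)) := by
        refine (Finset.abs_sum_le_sum_abs _ _).trans (Finset.sum_le_sum fun j hj => ?_)
        rw [Finset.mem_Ioc] at hj
        rw [← sub_one_mul, abs_mul, abs_of_nonneg (a := (m:ℝ) ^ (-β) * (j:ℝ) ^ (β - 1)) (by positivity)]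
        exact mul_le_mul_of_nonneg_right (hm j hj.1.le hj.2).le (by positivity)
    _ ≤ (ε / (L + 1) / 2) * (L + 1) := by
        rw [← Finset.mul_sum]
        exact mul_le_mul_of_nonneg_left hm2.le (by positivity)
    _ = ε / 2 := by field_simp
    _ < ε := by linarith

theorem T_tendsto {β A : ℝ} {f : ℕ → ℝ} {l : ℝ → ℝ} (hl : SlowlyVarying l)
    (hb : Tendsto (fun n : ℕ => l n * (n : ℝ) ^ (-β) * ∑ j ∈ Finset.Icc 1 n, f j)
      atTop (𝓝 (β⁻¹ * A))) :
    Tendsto (fun m : ℕ => l m * (m:ℝ) ^ (-β) * ∑ j ∈ Finset.Ioc m (2 * m), f j) atTop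
      (𝓝 (A * (β⁻¹ * (2 ^ β - 1)))) := by
  have h2 : Tendsto (fun m : ℕ => 2 * m) atTop atTop :=
    tendsto_id.const_mul_atTop' (by norm_num)
  have hb2 := hb.comp h2
  have hr := ((hl.2.2 2 (by norm_num)).comp tendsto_natCast_atTop_atTop).inv₀ one_ne_zero
  have := ((hr.mul_const ((2:ℝ)^β)).mul hb2).sub hb
  have e : (1:ℝ)⁻¹ * 2 ^ β * (β⁻¹ * A) - β⁻¹ * A = A * (β⁻¹ * (2 ^ β - 1)) := by ring
  rw [e] at this
  refine this.congr' ?_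
  filter_upwards [eventually_ge_atTop 1] with m hm
  have hm0 : (0:ℝ) < m := by exact_mod_cast hm
  have p1 := sv_pos hl hm0
  have p2 := sv_pos hl (x := 2 * (m:ℝ)) (by positivity)
  have e1 : ∑ j ∈ Finset.Icc 1 (2 * m), f j = ∑ j ∈ Finset.Icc 1 m, f j + ∑ j ∈ Finset.Ioc m (2 * m), f j := by
    rw [← Finset.sum_union]
    · congr 1; ext j; simp only [Finset.mem_union, Finset.mem_Icc, Finset.mem_Ioc]; omega
    · rw [Finset.disjoint_left]; intro j; simp only [Finset.mem_Icc, Finset.mem_Ioc]; omega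
  simp only [Function.comp, e1]
  push_cast
  rw [Real.mul_rpow (by norm_num) hm0.le, Real.rpow_neg (by norm_num : (0:ℝ) ≤ 2)]
  have p3 := Real.rpow_pos_of_pos (by norm_num : (0:ℝ) < 2) β
  field_simp
  ring

theorem block {β A : ℝ} (h0 : 0 < β) (h1 : β < 1) {f : ℕ → ℝ} {l : ℝ → ℝ} (hl : SlowlyVarying l)
    (ha : ∀ ε : ℝ, 0 < ε → ∃ N : ℕ, ∀ n ≥ N, A - ε ≤ l n * (n : ℝ) ^ (1 - β) * f n)
    (hb : Tendsto (fun n : ℕ => l n * (n : ℝ) ^ (-β) * ∑ j ∈ Finset.Icc 1 n, f j)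
      atTop (𝓝 (β⁻¹ * A))) (ε η : ℝ) (hε : 0 < ε) (hη : 0 < η) :
    ∀ᶠ m : ℕ in atTop, ∑ j ∈ Finset.Ioc m (2 * m),
      Set.indicator {n : ℕ | A + ε < l n * (n : ℝ) ^ (1 - β) * f n} (fun _ => (1:ℝ)) j ≤ η * m := by
  have hW := W_tendsto h0 h1 hl
  have hT := T_tendsto hl hb
  set L := β⁻¹ * ((2:ℝ) ^ β - 1) with hL
  have hLp : 0 ≤ L := by
    have : (1:ℝ) ≤ 2 ^ β := Real.one_le_rpow (by norm_num) h0.le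
    have := inv_pos.2 h0
    apply mul_nonneg this.le; linarith
  have hD := hT.sub (hW.const_mul A)
  rw [sub_self] at hD
  set τ := η * ε / 8 with hτ
  have hτp : 0 < τ := by positivity
  obtain ⟨N, hN⟩ := ha (τ / (L + 1)) (by positivity)
  filter_upwards [hD.eventually_lt_const hτp, hW.eventually_lt_const (lt_add_one L),
    sv_unif hl (1/2) (by norm_num), eventually_ge_atTop 1, eventually_ge_atTop N] with m k1 k2 k3 hm hmN
  have hm0 : (0:ℝ) < m := by exact_mod_cast hm
  set w : ℕ → ℝ := fun j => l m / l j * ((m:ℝ) ^ (-β) * (j:ℝ) ^ (β - 1)) with hw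
  set I : ℕ → ℝ := Set.indicator {n : ℕ | A + ε < l n * (n : ℝ) ^ (1 - β) * f n} (fun _ => (1:ℝ)) with hI
  have hI0 : ∀ j, 0 ≤ I j := fun j => Set.indicator_nonneg (by simp) j
  have step : ∀ j ∈ Finset.Ioc m (2 * m),
      (A - τ / (L + 1)) * w j + ε * (1 / (4 * m) * I j) ≤ l m * (m:ℝ) ^ (-β) * f j := by
    intro j hj
    rw [Finset.mem_Ioc] at hj
    have hj0 : (0:ℝ) < j := by exact_mod_cast (by omega : 0 < j)
    have hj2 : (j:ℝ) ≤ 2 * m := by exact_mod_cast hj.2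
    have lj := sv_pos hl hj0
    have lm := sv_pos hl hm0
    have r := k3 j hj.1.le hj.2
    rw [abs_lt] at r
    have hwj : 1 / (4 * m) ≤ w j := by
      have a1 : (2 * (m:ℝ)) ^ (β - 1) ≤ (j:ℝ) ^ (β - 1) :=
        Real.rpow_le_rpow_of_nonpos hj0 hj2 (by linarith)
      have a2 : (2:ℝ)⁻¹ ≤ 2 ^ (β - 1) := by
        rw [← Real.rpow_neg_one]
        exact Real.rpow_le_rpow_of_exponent_le (by norm_num) (by linarith)
      have a3 : (m:ℝ) ^ (-β) * (m:ℝ) ^ (β - 1) = (m:ℝ)⁻¹ := by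
        rw [← Real.rpow_add hm0, ← Real.rpow_neg_one]; congr 1; ring
      have a4 : (2:ℝ)⁻¹ * (m:ℝ)⁻¹ ≤ (m:ℝ) ^ (-β) * (j:ℝ) ^ (β - 1) := by
        calc (2:ℝ)⁻¹ * (m:ℝ)⁻¹ ≤ 2 ^ (β - 1) * (m:ℝ)⁻¹ := by gcongr
          _ = (m:ℝ) ^ (-β) * (2 * (m:ℝ)) ^ (β - 1) := by
            rw [Real.mul_rpow (by norm_num) hm0.le, ← a3]; ring
          _ ≤ _ := by gcongr
      calc 1 / (4 * (m:ℝ)) = (1/2) * ((2:ℝ)⁻¹ * (m:ℝ)⁻¹) := by field_simp; norm_num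
        _ ≤ l m / l j * ((m:ℝ) ^ (-β) * (j:ℝ) ^ (β - 1)) := by
          apply mul_le_mul (by linarith [r.1]) a4 (by positivity) (by linarith [r.1])
    have hwp : 0 < w j := lt_of_lt_of_le (by positivity) hwj
    have hid : l m * (m:ℝ) ^ (-β) * f j = w j * (l j * (j : ℝ) ^ (1 - β) * f j) := by
      have : (j:ℝ) ^ (β - 1) * (j : ℝ) ^ (1 - β) = 1 := by
        rw [← Real.rpow_add hj0]; simp
      simp only [hw]
      calc _ = l m * (m:ℝ) ^ (-β) * f j * ((j:ℝ) ^ (β - 1) * (j : ℝ) ^ (1 - β)) := by rw [this, mul_one]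
        _ = _ := by field_simp
    have hg : (A - τ / (L + 1)) + ε * I j ≤ l j * (j : ℝ) ^ (1 - β) * f j := by
      by_cases hc : j ∈ {n : ℕ | A + ε < l n * (n : ℝ) ^ (1 - β) * f n}
      · have : I j = 1 := Set.indicator_of_mem hc _
        rw [this]
        have hc' : A + ε < l j * (j : ℝ) ^ (1 - β) * f j := hc
        have : 0 < τ / (L + 1) := by positivity
        linarith
      · have : I j = 0 := Set.indicator_of_notMem hc _
        rw [this]
        linarith [hN j (by omega)]
    rw [hid]
    have b1 := mul_le_mul_of_nonneg_left hg hwp.le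
    have b2 := mul_le_mul_of_nonneg_right hwj (mul_nonneg hε.le (hI0 j))
    linarith
  have hs := Finset.sum_le_sum step
  rw [Finset.sum_add_distrib, ← Finset.mul_sum, ← Finset.mul_sum, ← Finset.mul_sum, ← Finset.mul_sum] at hs
  have c1 : τ / (L + 1) * ∑ j ∈ Finset.Ioc m (2 * m), w j ≤ τ := by
    calc _ ≤ τ / (L + 1) * (L + 1) := by gcongr
      _ = τ := by field_simp
  have c2 : ε * (1 / (4 * m) * ∑ j ∈ Finset.Ioc m (2 * m), I j) ≤ 2 * τ := by
    have : l m * (m:ℝ) ^ (-β) * ∑ j ∈ Finset.Ioc m (2 * m), f j - A * ∑ j ∈ Finset.Ioc m (2 * m), w j < τ := k1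
    linarith
  have c3 : ε * (1 / (4 * m) * ∑ j ∈ Finset.Ioc m (2 * m), I j) = (ε / (4 * m)) * ∑ j ∈ Finset.Ioc m (2 * m), I j := by ring
  rw [c3, ← le_div_iff₀' (by positivity)] at c2
  calc _ ≤ _ := c2
    _ = η * m := by rw [hτ]; field_simp; norm_num

theorem block_to_density (E : Set ℕ) (η : ℝ) (hη : 0 < η)
    (h : ∀ᶠ m : ℕ in atTop, ∑ j ∈ Finset.Ioc m (2 * m), Set.indicator E (fun _ => (1:ℝ)) j ≤ η * m) :
    ∀ᶠ n : ℕ in atTop, ∑ j ∈ Finset.Icc 1 n, Set.indicator E (fun _ => (1:ℝ)) j ≤ 3 * η * n := by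
  obtain ⟨M0, hM0⟩ := eventually_atTop.1 h
  set I : ℕ → ℝ := Set.indicator E (fun _ => (1:ℝ)) with hI
  have hI0 : ∀ j, 0 ≤ I j := fun j => Set.indicator_nonneg (by simp) j
  have hI1 : ∀ j, I j ≤ 1 := fun j => Set.indicator_le_self' (by simp) j
  set M := max M0 3 with hM
  have claim : ∀ n : ℕ, ∑ j ∈ Finset.Icc 1 n, I j ≤ 2 * M + 2 * η * n := by
    intro n
    induction n using Nat.strong_induction_on with
    | _ n ih =>
      by_cases hn : n < 2 * M
      · have : ∑ j ∈ Finset.Icc 1 n, I j ≤ n := by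
          calc _ ≤ ∑ j ∈ Finset.Icc 1 n, (1:ℝ) := Finset.sum_le_sum fun j _ => hI1 j
            _ = n := by simp
        have h2 : (n:ℝ) ≤ 2 * M := by exact_mod_cast hn.le
        have : 0 ≤ 2 * η * n := by positivity
        linarith
      · have hM3 : 3 ≤ M := le_max_right _ _
        have hMM : M0 ≤ M := le_max_left _ _
        obtain ⟨m, hm1, hm2⟩ : ∃ m : ℕ, n ≤ 2 * m ∧ 2 * m ≤ n + 1 := ⟨(n+1)/2, by omega, by omega⟩
        have i1 := ih m (by omega)
        have i2 := hM0 m (by omega)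
        have : ∑ j ∈ Finset.Icc 1 n, I j ≤ ∑ j ∈ Finset.Icc 1 m, I j + ∑ j ∈ Finset.Ioc m (2 * m), I j := by
          rw [← Finset.sum_union]
          · apply Finset.sum_le_sum_of_subset_of_nonneg
            · intro j; simp only [Finset.mem_union, Finset.mem_Icc, Finset.mem_Ioc]; omega
            · intro j _ _; exact hI0 j
          · rw [Finset.disjoint_left]; intro j; simp only [Finset.mem_Icc, Finset.mem_Ioc]; omega
        have h3 : (2:ℝ) * m ≤ n + 1 := by exact_mod_cast hm2
        have h4 : (3:ℝ) ≤ n := by exact_mod_cast (by omega : 3 ≤ n)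
        have : 3 * m ≤ 2 * (n:ℝ) := by linarith
        have := mul_le_mul_of_nonneg_left this hη.le
        linarith
  filter_upwards [(tendsto_natCast_atTop_atTop (R := ℝ)).eventually_ge_atTop (2 * M / η)] with n hn
  rw [div_le_iff₀ hη] at hn
  linarith [claim n]

theorem zero_density_convergence_from_liminf_and_cesaro
    (f : ℕ → ℝ) (A : ℝ) (β : ℝ) (hβ1 : 0 < β) (hβ2 : β < 1)
    (l : ℝ → ℝ) (hl : SlowlyVarying l)
    (ha : ∀ ε : ℝ, 0 < ε → ∃ N : ℕ, ∀ n ≥ N, A - ε ≤ l n * (n : ℝ) ^ (1 - β) * f n)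
    (hb : Tendsto (fun n : ℕ => l n * (n : ℝ) ^ (-β) * ∑ j ∈ Finset.Icc 1 n, f j)
      atTop (𝓝 (β⁻¹ * A))) :
    (∃ E : Set ℕ,
      Tendsto (fun n : ℕ =>
          (∑ j ∈ Finset.Icc 1 n, Set.indicator E (fun _ => (1 : ℝ)) j) / n)
        atTop (𝓝 0) ∧
      Tendsto (fun n : ℕ => l n * (n : ℝ) ^ (1 - β) * f n)
        (atTop ⊓ 𝓟 {n : ℕ | n ∉ E}) (𝓝 A)) ∧
    Filter.liminf (fun n : ℕ => l n * (n : ℝ) ^ (1 - β) * f n) atTop = A := by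
  have hblock := block hβ1 hβ2 hl ha hb
  set g : ℕ → ℝ := fun n => l n * (n : ℝ) ^ (1 - β) * f n with hg
  change ∀ ε η : ℝ, 0 < ε → 0 < η → ∀ᶠ m : ℕ in atTop, ∑ j ∈ Finset.Ioc m (2 * m),
      Set.indicator {n : ℕ | A + ε < g n} (fun _ => (1:ℝ)) j ≤ η * m at hblock
  change ∀ ε : ℝ, 0 < ε → ∃ N : ℕ, ∀ n ≥ N, A - ε ≤ g n at ha
  constructor
  · set F : ℕ → Set ℕ := fun k => {n | A + 1 / ((k:ℝ) + 1) < g n} with hF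
    have hFm : Monotone F := by
      intro a b hab n hn
      have : (1:ℝ) / ((b:ℝ) + 1) ≤ 1 / ((a:ℝ) + 1) := Nat.one_div_le_one_div hab
      simp only [hF, Set.mem_ofPred_eq] at hn ⊢
      linarith
    have hd : ∀ k : ℕ, ∃ N : ℕ, ∀ n ≥ N,
        ∑ j ∈ Finset.Icc 1 n, Set.indicator (F k) (fun _ => (1:ℝ)) j ≤ 1 / ((k:ℝ) + 1) * n := by
      intro k
      have := block_to_density (F k) (1 / ((k:ℝ) + 1) / 3) (by positivity)
        (hblock _ _ (by positivity) (by positivity))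
      obtain ⟨N, hN⟩ := eventually_atTop.1 this
      refine ⟨N, fun n hn => (hN n hn).trans_eq (by ring)⟩
    choose N hN using hd
    set K : ℕ → ℕ := fun n => Nat.findGreatest (fun k => N k ≤ n) n with hK
    have hKm : Monotone K := by
      intro a b hab
      exact Nat.findGreatest_mono (fun k hk => le_trans hk hab) hab
    have hKt : ∀ k n, k ≤ n → N k ≤ n → k ≤ K n := fun k n h1 h2 => Nat.le_findGreatest h1 h2
    have hKN : ∀ n, N 0 ≤ n → N (K n) ≤ n := fun n h =>
      Nat.findGreatest_spec (P := fun k => N k ≤ n) (Nat.zero_le n) h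
    refine ⟨{n | n ∈ F (K n)}, ?_, ?_⟩
    · rw [Metric.tendsto_nhds]
      intro ε hε
      obtain ⟨k, hk⟩ := exists_nat_one_div_lt hε
      filter_upwards [eventually_ge_atTop k, eventually_ge_atTop (N k), eventually_ge_atTop (N 0),
        eventually_ge_atTop 1] with n h1 h2 h3 h4
      have hn0 : (0:ℝ) < n := by exact_mod_cast h4
      rw [Real.dist_eq, sub_zero, abs_of_nonneg (div_nonneg (Finset.sum_nonneg fun j _ =>
        Set.indicator_nonneg (by simp) j) hn0.le), div_lt_iff₀ hn0]
      calc _ ≤ ∑ j ∈ Finset.Icc 1 n, Set.indicator (F (K n)) (fun _ => (1:ℝ)) j := by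
            refine Finset.sum_le_sum fun j hj => ?_
            rw [Finset.mem_Icc] at hj
            by_cases hc : j ∈ {n | n ∈ F (K n)}
            · rw [Set.indicator_of_mem hc, Set.indicator_of_mem (hFm (hKm hj.2) hc)]
            · rw [Set.indicator_of_notMem hc]
              exact Set.indicator_nonneg (by simp) j
        _ ≤ 1 / ((K n : ℝ) + 1) * n := hN _ n (hKN n h3)
        _ ≤ 1 / ((k : ℝ) + 1) * n := by
            have := Nat.one_div_le_one_div (α := ℝ) (hKt k n h1 h2)
            gcongr
        _ < ε * n := by gcongr
    · rw [Metric.tendsto_nhds]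
      intro ε hε
      rw [eventually_inf_principal]
      obtain ⟨k, hk⟩ := exists_nat_one_div_lt hε
      obtain ⟨N', hN'⟩ := ha (ε / 2) (by positivity)
      filter_upwards [eventually_ge_atTop k, eventually_ge_atTop (N k), eventually_ge_atTop N'] with n h1 h2 h3 h4
      have h5 := Nat.one_div_le_one_div (α := ℝ) (hKt k n h1 h2)
      have h6 : ¬ (A + 1 / ((K n:ℝ) + 1) < g n) := h4
      have h7 := hN' n h3
      rw [Real.dist_eq, abs_lt]
      constructor <;> linarith
  · have hfreq : ∀ ε : ℝ, 0 < ε → ∃ᶠ n in atTop, g n ≤ A + ε := by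
      intro ε hε hcon
      obtain ⟨N, hN⟩ := eventually_atTop.1 hcon
      obtain ⟨m, h1, h2, h3⟩ := ((hblock ε (1/2) hε (by norm_num)).and
        ((eventually_ge_atTop N).and (eventually_ge_atTop 1))).exists
      have : ∑ j ∈ Finset.Ioc m (2 * m), Set.indicator {n : ℕ | A + ε < g n} (fun _ => (1:ℝ)) j
          = ∑ j ∈ Finset.Ioc m (2 * m), 1 := by
        refine Finset.sum_congr rfl fun j hj => ?_
        rw [Finset.mem_Ioc] at hj
        have hmem : j ∈ {n : ℕ | A + ε < g n} := not_le.1 (hN j (by omega))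
        exact Set.indicator_of_mem hmem _
      rw [this] at h1
      have hm0 : (1:ℝ) ≤ m := by exact_mod_cast h3
      simp [two_mul] at h1
      linarith
    have hbdd : IsBoundedUnder (· ≥ ·) atTop g := by
      obtain ⟨N, hN⟩ := ha 1 one_pos
      exact ⟨A - 1, eventually_map.2 (eventually_atTop.2 ⟨N, hN⟩)⟩
    have hcob : IsCoboundedUnder (· ≥ ·) atTop g :=
      IsCobounded.of_frequently_le (hfreq 1 one_pos)
    apply le_antisymm
    · refine le_of_forall_pos_le_add fun ε hε => ?_
      exact liminf_le_of_frequently_le (hfreq ε hε) hbdd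
    · refine le_of_forall_pos_le_add fun ε hε => ?_
      obtain ⟨N, hN⟩ := ha ε hε
      have := le_liminf_of_le hcob (eventually_atTop.2 ⟨N, hN⟩)
      linarith
end

section
/- Second order expansion of the real part of the reciprocal characteristic function in the β = 1 case: let (Y,μ) be a probability space and φ : Y → {1,2,3,…} measurable with μ(φ > n) = c(n^{−1} + H(n)) for all n ≥ 1, where c > 0 and H(n) = O(n^{−q}) for some q ∈ (1,2). Let G(x) = μ(φ ≤ x), define H₁(x) = 1/c for x ∈ [0,1) and H₁(x) = (1 − G(x))/c − 1/x for x ≥ 1, and set c_H = ∫_0^1 (cos σ − 1)σ^{−1} dσ + ∫_1^∞ cos σ · σ^{−1} dσ + ∫_0^∞ H₁(x) dx (the second integral improper). Let λ(θ) = ∫_Y e^{iθφ} dμ. Then, as θ → 0⁺, Re{(1 − λ(θ))^{−1}} = c^{−1}(π/2)·θ^{−1}(log(1/θ))^{−2} − c^{−1} c_H π · θ^{−1}(log(1/θ))^{−3} + O(θ^{−1}(log(1/θ))^{−4}). -/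
open MeasureTheory Filter Topology

lemma aux_inner (M t : ℝ) : ∫ x in (0:ℝ)..M, Real.sin x * Real.exp (-(x*t)) =
    (1 + t^2)⁻¹ - Real.exp (-(M*t)) * ((t * Real.sin M + Real.cos M) / (1+t^2)) := by
  have h : ∀ x ∈ Set.uIcc (0:ℝ) M, HasDerivAt (fun x => -(t * Real.sin x + Real.cos x) / (1+t^2) * Real.exp (-(x*t)))
      (Real.sin x * Real.exp (-(x*t))) x := by
    intro x _
    have h1 : HasDerivAt (fun x => -(t * Real.sin x + Real.cos x) / (1+t^2)) (-(t * Real.cos x + -Real.sin x) / (1+t^2)) x :=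
      ((((Real.hasDerivAt_sin x).const_mul t).add (Real.hasDerivAt_cos x)).neg).div_const _
    have h2 : HasDerivAt (fun x => Real.exp (-(x*t))) (Real.exp (-(x*t)) * (-(1*t))) x :=
      (((hasDerivAt_id x).mul_const t).neg).exp
    refine (h1.mul h2).congr_deriv ?_
    have : 1 + t^2 ≠ 0 := by positivity
    field_simp
    ring
  rw [intervalIntegral.integral_eq_sub_of_hasDerivAt h (Continuous.intervalIntegrable (by fun_prop) _ _)]
  have : 1 + t^2 ≠ 0 := by positivity
  simp
  field_simp
  ring

lemma aux_exp_int (x : ℝ) (hx : 0 < x) : IntegrableOn (fun t => Real.exp (-(x*t))) (Set.Ioi 0) ∧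
   ∫ t in Set.Ioi (0:ℝ), Real.exp (-(x*t)) = x⁻¹ := by
  have h1 := integrableOn_exp_mul_Ioi (a := -x) (by linarith) 0
  have h2 := integral_exp_mul_Ioi (a := -x) (by linarith) 0
  simp only [neg_mul] at h1 h2
  refine ⟨h1, ?_⟩
  rw [h2]; simp

lemma aux_bound (s k t : ℝ) (hs : |s| ≤ 1) (hk : |k| ≤ 1) : |(t * s + k) / (1+t^2)| ≤ 2 := by
  rw [abs_div, abs_of_pos (show 0 < 1+t^2 by positivity), div_le_iff₀ (by positivity)]
  have : |t * s + k| ≤ |t| + 1 := by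
    refine (abs_add_le _ _).trans ?_
    rw [abs_mul]
    have := mul_le_mul_of_nonneg_left hs (abs_nonneg t)
    linarith
  nlinarith [sq_nonneg (|t| - 1), sq_abs t]

lemma dirichlet_aux (M : ℝ) (hM : 0 < M) :
    |(∫ x in (0:ℝ)..M, Real.sin x / x) - Real.pi / 2| ≤ 2 * M⁻¹ := by
  have hInt : Integrable (Function.uncurry fun (x t : ℝ) => Real.sin x * Real.exp (-(x*t)))
      ((volume.restrict (Set.Ioc 0 M)).prod (volume.restrict (Set.Ioi 0))) := by
    rw [integrable_prod_iff (Continuous.aestronglyMeasurable (by unfold Function.uncurry; fun_prop))]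
    constructor
    · filter_upwards [ae_restrict_mem measurableSet_Ioc] with x hx
      exact (aux_exp_int x hx.1).1.const_mul (Real.sin x)
    · refine Integrable.congr (f := fun x => |Real.sinc x|) ?_ ?_
      · exact (Real.continuous_sinc.abs).integrableOn_Ioc
      · filter_upwards [ae_restrict_mem measurableSet_Ioc] with x hx
        simp only [Function.uncurry, norm_mul, Real.norm_eq_abs, Real.abs_exp]
        rw [integral_const_mul, (aux_exp_int x hx.1).2, Real.sinc_of_ne_zero hx.1.ne', abs_div,
          abs_of_pos hx.1]
        rfl
  have e1 : ∫ x in (0:ℝ)..M, Real.sin x / x =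
      ∫ t in Set.Ioi (0:ℝ), ((1 + t^2)⁻¹ - Real.exp (-(M*t)) * ((t * Real.sin M + Real.cos M) / (1+t^2))) := by
    have := integral_integral_swap hInt
    simp only [← aux_inner]
    simp only [intervalIntegral.integral_of_le hM.le]
    rw [← this]
    refine setIntegral_congr_fun measurableSet_Ioc fun x hx => ?_
    rw [integral_const_mul, (aux_exp_int x hx.1).2]; rfl
  have i1 : IntegrableOn (fun t : ℝ => (1+t^2)⁻¹) (Set.Ioi 0) := integrable_inv_one_add_sq.integrableOn
  have i2 : IntegrableOn (fun t : ℝ => Real.exp (-(M*t)) * ((t * Real.sin M + Real.cos M) / (1+t^2))) (Set.Ioi 0) := by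
    refine Integrable.mul_bdd (c := 2) (aux_exp_int M hM).1 (Continuous.aestronglyMeasurable ?_) ?_
    · exact Continuous.div (by fun_prop) (by fun_prop) (fun t => by positivity)
    · exact Eventually.of_forall fun t => aux_bound _ _ _ (Real.abs_sin_le_one M) (Real.abs_cos_le_one M)
  rw [e1, integral_sub i1 i2, integral_Ioi_inv_one_add_sq, Real.arctan_zero, sub_zero, sub_sub_cancel_left, abs_neg]
  rw [← (aux_exp_int M hM).2, ← integral_const_mul, ← Real.norm_eq_abs]
  refine norm_integral_le_of_norm_le ((aux_exp_int M hM).1.const_mul 2) (Eventually.of_forall fun t => ?_)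
  rw [norm_mul, Real.norm_eq_abs, Real.norm_eq_abs, Real.abs_exp, mul_comm]
  exact mul_le_mul_of_nonneg_right (aux_bound _ _ _ (Real.abs_sin_le_one M) (Real.abs_cos_le_one M)) (Real.exp_pos _).le

lemma dirichlet : Tendsto (fun M : ℝ => ∫ x in (0:ℝ)..M, Real.sin x / x) atTop (𝓝 (Real.pi/2)) := by
  rw [tendsto_iff_norm_sub_tendsto_zero]
  refine squeeze_zero' (g := fun M => 2 * M⁻¹) (Eventually.of_forall fun _ => norm_nonneg _) ?_ ?_
  · filter_upwards [eventually_gt_atTop 0] with M hM using dirichlet_aux M hM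
  · simpa using tendsto_inv_atTop_zero.const_mul (2:ℝ)

lemma tail_lim {Y : Type*} [MeasurableSpace Y] (μ : Measure Y) [IsProbabilityMeasure μ]
    (φ : Y → ℕ) (hφ : Measurable φ) (g F : ℝ → ℝ) (hg : Continuous g)
    (hF : ∀ x, HasDerivAt F (g x) x) (hF0 : F 0 = 0) (C : ℝ) (hC : ∀ x, |F x| ≤ C) :
    Tendsto (fun M : ℝ => ∫ x in (0:ℝ)..M, g x * (μ {y | x < (φ y : ℝ)}).toReal) atTop
      (𝓝 (∫ y, F (φ y) ∂μ)) := by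
  have hFc : Continuous F := continuous_iff_continuousAt.2 fun x => (hF x).continuousAt
  have hφ' : Measurable (fun y => (φ y : ℝ)) := measurable_from_top.comp hφ
  have key : ∀ M : ℝ, 0 ≤ M → ∫ x in (0:ℝ)..M, g x * (μ {y | x < (φ y : ℝ)}).toReal
      = ∫ y, F (min M (φ y)) ∂μ := by
    intro M hM
    have hms : MeasurableSet {p : ℝ × Y | p.1 < (φ p.2 : ℝ)} :=
      measurableSet_lt measurable_fst (hφ'.comp measurable_snd)
    have hI : Integrable (Function.uncurry fun (x : ℝ) (y : Y) => Set.indicator {p : ℝ × Y | p.1 < (φ p.2 : ℝ)} (fun p => g p.1) (x,y))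
        ((volume.restrict (Set.Ioc 0 M)).prod μ) := by
      have : Integrable (fun p : ℝ × Y => g p.1) ((volume.restrict (Set.Ioc 0 M)).prod μ) :=
        Integrable.comp_fst (f := g) (hg.integrableOn_Ioc) μ
      exact this.indicator hms
    have := integral_integral_swap hI
    rw [intervalIntegral.integral_of_le hM]
    have e1 : ∀ x : ℝ, ∫ y, Set.indicator {p : ℝ × Y | p.1 < (φ p.2 : ℝ)} (fun p => g p.1) (x,y) ∂μ
        = g x * (μ {y | x < (φ y : ℝ)}).toReal := by
      intro x
      have hm : MeasurableSet {y | x < (φ y : ℝ)} := measurableSet_lt measurable_const hφ'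
      have : (fun y => Set.indicator {p : ℝ × Y | p.1 < (φ p.2 : ℝ)} (fun p => g p.1) (x,y))
         = Set.indicator {y | x < (φ y : ℝ)} (fun _ => g x) := by
        ext y; simp [Set.indicator]
      rw [this, integral_indicator_const _ hm, smul_eq_mul, mul_comm]; rfl
    simp only [e1] at this
    rw [this]
    refine integral_congr_ae (Eventually.of_forall fun y => ?_)
    simp only
    have hmin : 0 ≤ min M (φ y : ℝ) := le_min hM (Nat.cast_nonneg _)
    have e2 : F (min M (φ y)) = ∫ x in (0:ℝ)..(min M (φ y)), g x := by
      rw [intervalIntegral.integral_eq_sub_of_hasDerivAt (fun x _ => hF x) (hg.intervalIntegrable _ _), hF0, sub_zero]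
    rw [e2, intervalIntegral.integral_of_le hmin, integral_Ioc_eq_integral_Ioo, integral_Ioc_eq_integral_Ioo,
      ← integral_indicator measurableSet_Ioo, ← integral_indicator measurableSet_Ioo]
    congr 1
    ext x
    simp only [Set.indicator, Set.mem_Ioo, Set.mem_ofPred_eq, lt_min_iff]
    split_ifs <;> first | rfl | (exfalso; tauto)
  have lim : Tendsto (fun M : ℝ => ∫ y, F (min M (φ y)) ∂μ) atTop (𝓝 (∫ y, F (φ y) ∂μ)) := by
    refine tendsto_integral_filter_of_dominated_convergence (fun _ => C) ?_ ?_ (integrable_const _) ?_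
    · exact Eventually.of_forall fun M => (hFc.measurable.comp (measurable_const.min hφ')).aestronglyMeasurable
    · exact Eventually.of_forall fun M => Eventually.of_forall fun y => hC _
    · refine Eventually.of_forall fun y => ?_
      refine tendsto_const_nhds.congr' ?_
      filter_upwards [eventually_ge_atTop (φ y : ℝ)] with M hM
      rw [min_eq_right hM]
  refine lim.congr' ?_
  filter_upwards [eventually_ge_atTop 0] with M hM using (key M hM).symm

lemma alg1 (B c θ S h L p : ℝ) (hc : c ≠ 0) (hθ : θ ≠ 0) (hS : S ≠ 0) (hL : L ≠ 0) :
    B / (c * θ * S) - (c⁻¹ * (p / 2) / (θ * L ^ 2) - c⁻¹ * h * p / (θ * L ^ 3)) =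
      (B * L^4 - (p/2*L^2 - p*h*L)*S) / (c * θ * L^4 * S) := by
  field_simp

lemma alg2 (Q c θ S L : ℝ) (hc : c ≠ 0) (hθ : θ ≠ 0) (hL : L ≠ 0) :
    4 * Q / c / (θ * L^4) * (c * θ * L^4 * S) = 4 * Q * S := by
  field_simp

set_option maxHeartbeats 1000000 in
lemma final_alg (c θ L A B h D : ℝ) (hc : 0 < c) (hθ : 0 < θ) (hD : 0 ≤ D) (hL1 : 1 ≤ L)
    (hL2 : 2 * (|h| + D) ≤ L) (hA : |A - L - h| ≤ D / L^2) (hB : |B - Real.pi/2| ≤ D / L^2)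
    (E : ℝ) (hE : E = h^2+2*D+2*D*|h|+D^2+(2+D)^2) :
    |B / (c * θ * (A^2+B^2)) - (c⁻¹ * (Real.pi / 2) / (θ * L ^ 2)
             - c⁻¹ * h * Real.pi / (θ * L ^ 3))| ≤ (4 * (D + 2*E+8*h^2+4*|h| * E) / c) / (θ * L^4) := by
  have hL : 0 < L := by linarith
  obtain ⟨a, ha⟩ : ∃ a, a = A - L - h := ⟨_, rfl⟩
  obtain ⟨b, hb⟩ : ∃ b, b = B - Real.pi/2 := ⟨_, rfl⟩
  rw [← ha] at hA
  rw [← hb] at hB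
  have hA' : |a| * L^2 ≤ D := by rwa [le_div_iff₀ (by positivity)] at hA
  have hB' : |b| * L^2 ≤ D := by rwa [le_div_iff₀ (by positivity)] at hB
  have haL : |a * L| ≤ D := by
    rw [abs_mul, abs_of_pos hL]
    nlinarith [mul_nonneg (abs_nonneg a) hL.le]
  have ha1 : |a| ≤ D := by
    nlinarith [mul_nonneg (abs_nonneg a) hL.le, abs_nonneg a]
  have hb1 : |b| ≤ D := by
    nlinarith [mul_nonneg (abs_nonneg b) hL.le, abs_nonneg b]
  have hpi : Real.pi ≤ 4 := Real.pi_le_four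
  have hpi0 := Real.pi_pos
  have hBabs : |B| ≤ 2 + D := by
    have := abs_le.1 hb1
    rw [abs_le]; constructor <;> linarith
  have hAl : L / 2 ≤ A := by
    have := abs_le.1 ha1
    have := abs_le.1 (le_refl |h|)
    linarith
  have hS : L^2/4 ≤ A^2+B^2 := by nlinarith [sq_nonneg B]
  have hSpos : 0 < A^2+B^2 := lt_of_lt_of_le (by positivity) hS
  obtain ⟨e, he⟩ : ∃ e, e = h^2 + 2*(a*L) + 2*a*h + a^2+B^2 := ⟨_, rfl⟩
  have heE : |e| ≤ E := by
    rw [he, hE]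
    have h1 : |a * h| ≤ D * |h| := by rw [abs_mul]; exact mul_le_mul_of_nonneg_right ha1 (abs_nonneg _)
    have h2 : a^2 ≤ D^2 := sq_le_sq' (abs_le.1 ha1).1 (abs_le.1 ha1).2
    have h3 : B^2 ≤ (2+D)^2 := sq_le_sq' (abs_le.1 hBabs).1 (abs_le.1 hBabs).2
    have := abs_le.1 h1
    have := abs_le.1 haL
    rw [abs_le]; constructor <;> nlinarith [sq_nonneg h, sq_nonneg a, sq_nonneg B, sq_nonneg D, sq_nonneg (2+D)]
  have hE0 : 0 ≤ E := (abs_nonneg e).trans heE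
  have hN : |B * L^4 - (Real.pi/2*L^2 - Real.pi*h*L)*(A^2+B^2)| ≤ (D + 2*E+8*h^2+4*|h| * E) * L^2 := by
    have : B * L^4 - (Real.pi/2*L^2 - Real.pi*h*L)*(A^2+B^2)
      = b * L^2 * L^2 + (-(Real.pi/2 * e)*L^2) + (Real.pi * h * (2 * h * L + e)) * L := by
      have hA2 : A = L + h + a := by rw [ha]; ring
      have hB2 : b = B - Real.pi/2 := hb
      rw [hb, he, hA2]; ring
    rw [this]
    have t1 : |b * L^2 * L^2| ≤ D * L^2 := by
      rw [abs_mul, abs_mul, abs_of_pos (show 0 < L^2 by positivity)]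
      exact mul_le_mul_of_nonneg_right hB' (by positivity)
    have t2 : |(-(Real.pi/2 * e)*L^2)| ≤ 2*E*L^2 := by
      rw [abs_mul, abs_neg, abs_mul, abs_of_pos (show 0 < L^2 by positivity), abs_of_pos (show 0 < Real.pi/2 by positivity)]
      gcongr; linarith
    have t3 : |(Real.pi * h * (2 * h * L + e)) * L| ≤ (4 * |h| * (2 * |h| * L + E * L)) * L := by
      rw [abs_mul, abs_mul, abs_mul, abs_of_pos hL, abs_of_pos hpi0]
      gcongr
      refine (abs_add_le _ _).trans ?_
      rw [abs_mul, abs_mul, abs_of_pos hL, abs_two]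
      gcongr
      nlinarith
    have hh : |h| * |h| = h^2 := by rw [← sq, sq_abs]
    have t4 : (4 * |h| * (2 * |h| * L + E * L)) * L = (8*h^2+4*|h| * E)*L^2 := by rw [← hh]; ring
    refine (abs_add_three _ _ _).trans ?_
    rw [t4] at t3
    linarith
  rw [alg1 B c θ (A^2+B^2) h L Real.pi hc.ne' hθ.ne' hSpos.ne' hL.ne', abs_div, abs_of_pos (show 0 < c * θ * L^4 * (A^2+B^2) by positivity), div_le_iff₀ (by positivity)]
  refine hN.trans ?_
  have hQ : 0 ≤ D + 2*E+8*h^2+4*|h| * E := by positivity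
  rw [alg2 _ c θ (A^2+B^2) L hc.ne' hθ.ne' hL.ne']
  generalize D + 2*E+8*h^2+4*|h| * E = Q at hQ ⊢
  nlinarith

lemma pow_log (δ θ : ℝ) (hδ : 0 < δ) (hθ : 0 < θ) (hθ1 : θ < 1) :
    θ ^ δ ≤ (2 / δ^2) / (Real.log (1/θ))^2 := by
  have hL : 0 < Real.log (1/θ) := Real.log_pos (by rw [lt_div_iff₀ hθ]; linarith)
  obtain ⟨L, hLd⟩ : ∃ L, L = Real.log (1/θ) := ⟨_, rfl⟩
  rw [← hLd] at hL ⊢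
  have h1 : Real.log θ = -L := by rw [hLd]; simp
  rw [Real.rpow_def_of_pos hθ, h1, le_div_iff₀ (by positivity), neg_mul, Real.exp_neg,
    inv_mul_le_iff₀ (Real.exp_pos _)]
  have := Real.quadratic_le_exp_of_nonneg (x := L * δ) (by positivity)
  have h2 : (L*δ)^2/2 ≤ Real.exp (L*δ) := by nlinarith [mul_pos hL hδ]
  calc L^2 = (L*δ)^2/2 * (2/δ^2) := by field_simp
    _ ≤ _ := by gcongr

lemma sin_bd (u δ : ℝ) (hu : 0 < u) (hδ : 0 < δ) (hδ1 : δ ≤ 1) : |Real.sin u| ≤ u ^ δ := by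
  rcases le_total u 1 with h | h
  · have h1 : |Real.sin u| ≤ u := by
      have := Real.abs_sin_le_abs (x := u); rwa [abs_of_pos hu] at this
    refine h1.trans ?_
    calc u = u ^ (1:ℝ) := (Real.rpow_one u).symm
      _ ≤ _ := Real.rpow_le_rpow_of_exponent_ge hu h hδ1
  · exact (Real.abs_sin_le_one u).trans (Real.one_le_rpow h hδ.le)

lemma cos_bd (u δ : ℝ) (hu : 0 < u) (hδ : 0 < δ) (hδ1 : δ ≤ 1) : |Real.cos u - 1| ≤ 2 * u ^ δ := by
  have h0 : |Real.cos u - 1| = 1 - Real.cos u := by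
    rw [abs_sub_comm, abs_of_nonneg]; linarith [Real.cos_le_one u]
  rw [h0]
  rcases le_total u 1 with h | h
  · have h1 := Real.one_sub_sq_div_two_le_cos (x := u)
    have : u ≤ u ^ δ := by
      calc u = u ^ (1:ℝ) := (Real.rpow_one u).symm
        _ ≤ _ := Real.rpow_le_rpow_of_exponent_ge hu h hδ1
    nlinarith
  · have := Real.one_le_rpow h hδ.le
    linarith [Real.neg_one_le_cos u]

lemma assemble {Y : Type*} [MeasurableSpace Y] (μ : Measure Y)
    (φ : Y → ℕ) (c : ℝ) (g H₁ : ℝ → ℝ) (hg : Continuous g) (hgb : ∀ x, |g x| ≤ 1)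
    (h0 : ∀ x, 0 < x → x < 1 → (μ {y | x < (φ y : ℝ)}).toReal = c * H₁ x)
    (h1 : ∀ x, 1 ≤ x → (μ {y | x < (φ y : ℝ)}).toReal = c * (H₁ x + 1 / x))
    (hint : IntegrableOn H₁ (Set.Ioi 0)) (l R : ℝ)
    (hl : Tendsto (fun M : ℝ => ∫ x in (1:ℝ)..M, g x / x) atTop (𝓝 l))
    (hR : Tendsto (fun M : ℝ => ∫ x in (0:ℝ)..M, g x * (μ {y | x < (φ y : ℝ)}).toReal) atTop (𝓝 R)) :
    IntegrableOn (fun x => g x * H₁ x) (Set.Ioi 0) ∧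
    R = c * ((∫ x in Set.Ioi (0:ℝ), g x * H₁ x) + l) := by
  have hI : IntegrableOn (fun x => g x * H₁ x) (Set.Ioi 0) :=
    Integrable.bdd_mul (c := 1) hint hg.aestronglyMeasurable (Eventually.of_forall hgb)
  refine ⟨hI, ?_⟩
  have hII : ∀ a b : ℝ, 0 ≤ a → a ≤ b → IntervalIntegrable (fun x => g x * H₁ x) volume a b := by
    intro a b ha hab
    rw [intervalIntegrable_iff_integrableOn_Ioc_of_le hab]
    exact hI.mono_set fun x hx => lt_of_le_of_lt ha hx.1
  have hlim := (intervalIntegral_tendsto_integral_Ioi 0 hI tendsto_id).add hl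
  refine tendsto_nhds_unique hR ((hlim.const_mul c).congr' ?_)
  filter_upwards [eventually_ge_atTop 1] with M hM
  have hgi : IntervalIntegrable (fun x => g x / x) volume 1 M := by
    refine ContinuousOn.intervalIntegrable (hg.continuousOn.div continuousOn_id ?_)
    intro x hx
    rw [Set.uIcc_of_le hM] at hx
    have : (0:ℝ) < x := by linarith [hx.1]
    exact this.ne'
  have e0 : Set.EqOn (fun x => g x * (μ {y | x < (φ y : ℝ)}).toReal) (fun x => c * (g x * H₁ x)) (Set.Ioo 0 1) := by
    intro x hx
    simp only; rw [h0 x hx.1 hx.2]; ring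
  have e1 : Set.EqOn (fun x => g x * (μ {y | x < (φ y : ℝ)}).toReal) (fun x => c * (g x * H₁ x + g x / x)) (Set.Ioc 1 M) := by
    intro x hx
    simp only; rw [h1 x hx.1.le]; ring
  have i0 : IntervalIntegrable (fun x => g x * (μ {y | x < (φ y : ℝ)}).toReal) volume 0 1 := by
    rw [intervalIntegrable_iff_integrableOn_Ioo_of_le zero_le_one, integrableOn_congr_fun e0 measurableSet_Ioo,
      ← intervalIntegrable_iff_integrableOn_Ioo_of_le zero_le_one]
    exact (hII 0 1 le_rfl zero_le_one).const_mul c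
  have i1 : IntervalIntegrable (fun x => g x * (μ {y | x < (φ y : ℝ)}).toReal) volume 1 M := by
    rw [intervalIntegrable_iff_integrableOn_Ioc_of_le hM, integrableOn_congr_fun e1 measurableSet_Ioc,
      ← intervalIntegrable_iff_integrableOn_Ioc_of_le hM]
    exact ((hII 1 M zero_le_one hM).add hgi).const_mul c
  rw [← intervalIntegral.integral_add_adjacent_intervals i0 i1]
  have v0 : ∫ x in (0:ℝ)..1, g x * (μ {y | x < (φ y : ℝ)}).toReal = c * ∫ x in (0:ℝ)..1, g x * H₁ x := by
    rw [← intervalIntegral.integral_const_mul, intervalIntegral.integral_of_le zero_le_one, intervalIntegral.integral_of_le zero_le_one,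
      integral_Ioc_eq_integral_Ioo, integral_Ioc_eq_integral_Ioo]
    exact setIntegral_congr_fun measurableSet_Ioo e0
  have v1 : ∫ x in (1:ℝ)..M, g x * (μ {y | x < (φ y : ℝ)}).toReal =
      c * ((∫ x in (1:ℝ)..M, g x * H₁ x) + ∫ x in (1:ℝ)..M, g x / x) := by
    rw [← intervalIntegral.integral_add (hII 1 M zero_le_one hM) hgi, ← intervalIntegral.integral_const_mul,
      intervalIntegral.integral_of_le hM, intervalIntegral.integral_of_le hM]
    exact setIntegral_congr_fun measurableSet_Ioc e1
  rw [v0, v1]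
  simp only [id]
  rw [← intervalIntegral.integral_add_adjacent_intervals (hII 0 1 le_rfl zero_le_one) (hII 1 M zero_le_one hM)]
  ring

lemma H1_bound (q : ℝ) (hq1 : 1 < q) (hq2 : q < 2) (H : ℕ → ℝ) (K : ℝ)
    (hH : ∀ n : ℕ, 1 ≤ n → |H n| ≤ K * (n : ℝ) ^ (-q)) (x : ℝ) (hx : 1 ≤ x) :
    |(((⌊x⌋₊ : ℝ)⁻¹ + H ⌊x⌋₊) - 1 / x)| ≤ (2 + K * 2^q) * x ^ (-q) := by
  have hn1 : 1 ≤ ⌊x⌋₊ := (Nat.one_le_floor_iff x).2 hx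
  obtain ⟨n, hn⟩ : ∃ n, n = ⌊x⌋₊ := ⟨_, rfl⟩
  have hnx : (n:ℝ) ≤ x := by rw [hn]; exact Nat.floor_le (by linarith)
  have hxn : x < n + 1 := by rw [hn]; exact Nat.lt_floor_add_one x
  rw [← hn] at hn1 ⊢
  have hn1' : (1:ℝ) ≤ n := by exact_mod_cast hn1
  have hx0 : 0 < x := by linarith
  have hn0 : (0:ℝ) < n := by linarith
  have hK : 0 ≤ K := by
    have := hH 1 le_rfl
    simp at this
    exact (abs_nonneg _).trans this
  have t1 : |(n:ℝ)⁻¹ - 1/x| ≤ 2 * x^(-q) := by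
    have e : (n:ℝ)⁻¹ - 1/x = (x - n)/(n*x) := by field_simp
    rw [e, abs_of_nonneg (div_nonneg (by linarith) (by positivity))]
    have : (x - n)/(n*x) ≤ 2 * (x^2)⁻¹ := by
      rw [div_le_iff₀ (by positivity)]
      have : 2 * (x^2)⁻¹ * (n*x) = 2 * n / x := by field_simp
      rw [this, le_div_iff₀ hx0]
      nlinarith
    refine this.trans ?_
    have : (x^2)⁻¹ = x ^ (-2:ℝ) := by rw [Real.rpow_neg hx0.le]; norm_num
    rw [this]
    gcongr
  have t2 : |H n| ≤ K * 2^q * x^(-q) := by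
    refine (hH n hn1).trans ?_
    rw [mul_assoc]
    refine mul_le_mul_of_nonneg_left ?_ hK
    have : (n:ℝ)^(-q) ≤ (x/2)^(-q) :=
      Real.rpow_le_rpow_of_nonpos (by positivity) (by linarith) (by linarith)
    refine this.trans (le_of_eq ?_)
    rw [Real.div_rpow hx0.le zero_le_two, Real.rpow_neg zero_le_two, div_inv_eq_mul, mul_comm]
  calc |((n:ℝ)⁻¹ + H n) - 1/x| = |((n:ℝ)⁻¹ - 1/x) + H n| := by ring_nf
    _ ≤ _ := abs_add_le _ _
    _ ≤ _ := by linarith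

lemma H1_weight (q K' : ℝ) (hq1 : 1 < q) (H₁ : ℝ → ℝ)
    (hint : IntegrableOn H₁ (Set.Ioi 0)) (hb : ∀ x, 1 ≤ x → |H₁ x| ≤ K' * x ^ (-q)) :
    IntegrableOn (fun x => x ^ ((q-1)/2) * |H₁ x|) (Set.Ioi 0) := by
  have hm : AEStronglyMeasurable (fun x => x ^ ((q-1)/2) * |H₁ x|) (volume.restrict (Set.Ioi 0)) :=
    ((by fun_prop : Measurable fun x : ℝ => x ^ ((q-1)/2)).aestronglyMeasurable).mul
     (hint.aestronglyMeasurable.norm)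
  rw [← Set.Ioc_union_Ioi_eq_Ioi (zero_le_one' ℝ)]
  refine IntegrableOn.union ?_ ?_
  · refine Integrable.mono' (g := fun x => |H₁ x|) ((hint.mono_set fun x hx => hx.1).abs)
      (hm.mono_measure (Measure.restrict_mono (fun x hx => hx.1) le_rfl)) ?_
    filter_upwards [ae_restrict_mem measurableSet_Ioc] with x hx
    rw [norm_mul, Real.norm_eq_abs, Real.norm_eq_abs, abs_abs, abs_of_nonneg (Real.rpow_nonneg hx.1.le _)]
    exact mul_le_of_le_one_left (abs_nonneg _) (Real.rpow_le_one hx.1.le hx.2 (by linarith))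
  · have : IntegrableOn (fun x : ℝ => K' * x ^ ((q-1)/2 - q)) (Set.Ioi 1) :=
      (integrableOn_Ioi_rpow_of_lt (by linarith) one_pos).const_mul _
    refine Integrable.mono' this
      (hm.mono_measure (Measure.restrict_mono (Set.Ioi_subset_Ioi zero_le_one) le_rfl)) ?_
    filter_upwards [ae_restrict_mem measurableSet_Ioi] with x hx
    have hx0 : (0:ℝ) < x := lt_trans one_pos hx
    rw [norm_mul, Real.norm_eq_abs, Real.norm_eq_abs, abs_abs, abs_of_nonneg (Real.rpow_nonneg hx0.le _)]
    have := mul_le_mul_of_nonneg_left (hb x (le_of_lt hx)) (Real.rpow_nonneg hx0.le ((q-1)/2))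
    refine this.trans (le_of_eq ?_)
    rw [sub_eq_add_neg _ q, Real.rpow_add hx0]; ring

lemma scale_lim (g : ℝ → ℝ) (θ l : ℝ) (hθ : 0 < θ)
    (h : Tendsto (fun N : ℝ => ∫ σ in θ..N, g σ / σ) atTop (𝓝 l)) :
    Tendsto (fun M : ℝ => ∫ x in (1:ℝ)..M, g (θ * x) / x) atTop (𝓝 l) := by
  have h2 := h.comp (tendsto_id.const_mul_atTop hθ)
  refine h2.congr fun M => ?_
  simp only [Function.comp, id]
  have := intervalIntegral.integral_comp_mul_left (a := 1) (b := M) (fun σ => g σ / σ) hθ.ne'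
  rw [mul_one, smul_eq_mul] at this
  have e : ∫ x in (1:ℝ)..M, g (θ * x) / x = ∫ x in (1:ℝ)..M, θ * (g (θ * x) / (θ * x)) := by
    congr 1; ext x
    rw [mul_div_assoc', mul_div_mul_left _ _ hθ.ne']
  rw [e, intervalIntegral.integral_const_mul, this, ← mul_assoc, mul_inv_cancel₀ hθ.ne', one_mul]

lemma bdd_ii (f : ℝ → ℝ) (hf : Measurable f) (C a b : ℝ) (ha : 0 ≤ a) (hab : a ≤ b) (hC : ∀ x, 0 < x → |f x| ≤ C) :
    IntervalIntegrable f volume a b := by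
  rw [intervalIntegrable_iff_integrableOn_Ioc_of_le hab]
  refine Integrable.mono' (g := fun _ => C) (integrable_const C) hf.aestronglyMeasurable ?_
  filter_upwards [ae_restrict_mem measurableSet_Ioc] with x hx using hC x (lt_of_le_of_lt ha hx.1)

lemma cos_div_bd (x : ℝ) (hx : 0 < x) : |(Real.cos x - 1)/x| ≤ 2 := by
  rw [abs_div, abs_of_pos hx, div_le_iff₀ hx]
  simpa using cos_bd x 1 hx one_pos le_rfl

lemma sin_div_bd (x : ℝ) (hx : 0 < x) : |Real.sin x/x| ≤ 1 := by
  rw [abs_div, abs_of_pos hx, div_le_iff₀ hx]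
  simpa using sin_bd x 1 hx one_pos le_rfl

lemma small_int (f : ℝ → ℝ) (C θ : ℝ) (hθ : 0 < θ) (hC : ∀ x, 0 < x → |f x| ≤ C) :
    |∫ x in (0:ℝ)..θ, f x| ≤ C * θ := by
  have := intervalIntegral.norm_integral_le_of_norm_le_const (a := 0) (b := θ) (f := f) (C := C) (by
    intro x hx
    rw [Set.uIoc_of_le hθ.le] at hx
    exact hC x hx.1)
  rwa [sub_zero, abs_of_pos hθ] at this

lemma cos_lim (Icos : ℝ)
    (hIcos : Tendsto (fun M : ℝ => ∫ σ in (1 : ℝ)..M, Real.cos σ / σ) atTop (𝓝 Icos)) (θ : ℝ) (hθ : 0 < θ) (hθ1 : θ < 1) :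
    Tendsto (fun N : ℝ => ∫ σ in θ..N, Real.cos σ / σ) atTop
      (𝓝 (Real.log (1/θ) + (∫ σ in (0 : ℝ)..1, (Real.cos σ - 1) / σ) - (∫ σ in (0 : ℝ)..θ, (Real.cos σ - 1) / σ) + Icos)) := by
  have hii : ∀ a b : ℝ, 0 < a → a ≤ b → IntervalIntegrable (fun σ => Real.cos σ / σ) volume a b := by
    intro a b ha hab
    refine ContinuousOn.intervalIntegrable (Real.continuous_cos.continuousOn.div continuousOn_id ?_)
    intro x hx
    rw [Set.uIcc_of_le hab] at hx
    exact (lt_of_lt_of_le ha hx.1).ne'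
  have hi1 : IntervalIntegrable (fun σ : ℝ => 1 / σ) volume θ 1 := by
    refine ContinuousOn.intervalIntegrable (continuousOn_const.div continuousOn_id ?_)
    intro x hx
    rw [Set.uIcc_of_le hθ1.le] at hx
    exact (lt_of_lt_of_le hθ hx.1).ne'
  have hm : Measurable (fun σ : ℝ => (Real.cos σ - 1)/σ) := by fun_prop
  have j1 := bdd_ii _ hm 2 0 θ le_rfl hθ.le cos_div_bd
  have j2 := bdd_ii _ hm 2 θ 1 hθ.le hθ1.le cos_div_bd
  have e1 : ∫ σ in θ..1, Real.cos σ / σ = Real.log (1/θ) + ((∫ σ in (0 : ℝ)..1, (Real.cos σ - 1) / σ) - (∫ σ in (0 : ℝ)..θ, (Real.cos σ - 1) / σ)) := by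
    rw [← intervalIntegral.integral_add_adjacent_intervals j1 j2, add_sub_cancel_left,
      ← integral_one_div_of_pos hθ one_pos, ← intervalIntegral.integral_add hi1 j2]
    congr 1; ext x; ring
  rw [← add_sub_assoc] at e1
  rw [← e1]
  refine (hIcos.const_add _).congr' ?_
  filter_upwards [eventually_ge_atTop 1] with N hN
  exact intervalIntegral.integral_add_adjacent_intervals (hii θ 1 hθ hθ1.le) (hii 1 N one_pos hN)

lemma sin_lim (θ : ℝ) (hθ : 0 < θ) :
    Tendsto (fun N : ℝ => ∫ σ in θ..N, Real.sin σ / σ) atTop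
      (𝓝 (Real.pi/2 - (∫ σ in (0 : ℝ)..θ, Real.sin σ / σ))) := by
  refine (dirichlet.sub_const _).congr' ?_
  filter_upwards [eventually_ge_atTop θ] with N hN
  have hm : Measurable (fun σ : ℝ => Real.sin σ/σ) := by fun_prop
  have j1 := bdd_ii _ hm 1 0 θ le_rfl hθ.le sin_div_bd
  have j2 := bdd_ii _ hm 1 θ N hθ.le hN sin_div_bd
  rw [← intervalIntegral.integral_add_adjacent_intervals j1 j2, add_sub_cancel_left]

lemma weight_int (q : ℝ) (H₁ f : ℝ → ℝ) (θ C : ℝ) (hθ : 0 < θ)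
    (hw : IntegrableOn (fun x => x ^ ((q-1)/2) * |H₁ x|) (Set.Ioi 0))
    (hf : ∀ u, 0 < u → |f u| ≤ C * u ^ ((q-1)/2)) :
    |∫ x in Set.Ioi (0:ℝ), f (θ * x) * H₁ x| ≤ C * θ ^ ((q-1)/2) * ∫ x in Set.Ioi (0:ℝ), x ^ ((q-1)/2) * |H₁ x| := by
  rw [← integral_const_mul, ← Real.norm_eq_abs]
  refine norm_integral_le_of_norm_le (hw.const_mul _) ?_
  filter_upwards [ae_restrict_mem measurableSet_Ioi] with x hx
  have hx' : 0 < x := hx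
  rw [norm_mul, Real.norm_eq_abs, Real.norm_eq_abs]
  have := mul_le_mul_of_nonneg_right (hf (θ * x) (by positivity)) (abs_nonneg (H₁ x))
  refine this.trans (le_of_eq ?_)
  rw [Real.mul_rpow hθ.le hx'.le]; ring

lemma complex_part {Y : Type*} [MeasurableSpace Y] (μ : Measure Y) [IsProbabilityMeasure μ]
    (φ : Y → ℕ) (hφ : Measurable φ) (θ c A B : ℝ) (hθ : 0 < θ) (hc : 0 < c)
    (hA : ∫ y, Real.sin (θ * (φ y : ℝ)) / θ ∂μ = c * A)
    (hB : ∫ y, (1 - Real.cos (θ * (φ y : ℝ))) / θ ∂μ = c * B) :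
    ((1 - ∫ y, Complex.exp (Complex.I * θ * (φ y : ℝ)) ∂μ)⁻¹).re = B / (c * θ * (A^2+B^2)) := by
  have hφ' : Measurable (fun y => (φ y : ℝ)) := measurable_from_top.comp hφ
  have hn : ∀ y, Complex.exp (Complex.I * θ * (φ y : ℝ)) = Complex.exp ((θ * (φ y : ℝ) : ℝ) * Complex.I) := by
    intro y; push_cast; ring_nf
  have hI : Integrable (fun y => Complex.exp (Complex.I * θ * (φ y : ℝ))) μ := by
    refine Integrable.mono' (g := fun _ => 1) (integrable_const _) ?_ ?_
    · exact Measurable.aestronglyMeasurable (by fun_prop)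
    · refine Eventually.of_forall fun y => ?_
      rw [hn, Complex.norm_exp_ofReal_mul_I]
  have hre : (∫ y, Complex.exp (Complex.I * θ * (φ y : ℝ)) ∂μ).re = ∫ y, Real.cos (θ * (φ y : ℝ)) ∂μ := by
    have := integral_re hI
    simp only [RCLike.re_to_complex] at this
    rw [← this]
    congr 1; ext y
    rw [hn, Complex.exp_ofReal_mul_I_re]
  have him : (∫ y, Complex.exp (Complex.I * θ * (φ y : ℝ)) ∂μ).im = ∫ y, Real.sin (θ * (φ y : ℝ)) ∂μ := by
    have := integral_im hI
    simp only [RCLike.im_to_complex] at this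
    rw [← this]
    congr 1; ext y
    rw [hn, Complex.exp_ofReal_mul_I_im]
  have hcosI : Integrable (fun y => Real.cos (θ * (φ y : ℝ))) μ := by
    refine Integrable.mono' (g := fun _ => 1) (integrable_const _) ?_ (Eventually.of_forall fun y => Real.abs_cos_le_one _)
    exact Measurable.aestronglyMeasurable (by fun_prop)
  rw [integral_div, div_eq_iff hθ.ne'] at hA hB
  rw [integral_sub (integrable_const _) hcosI] at hB
  simp only [integral_const, probReal_univ, smul_eq_mul, mul_one] at hB
  rw [Complex.inv_re, Complex.normSq_apply]
  simp only [Complex.sub_re, Complex.sub_im, Complex.one_re, Complex.one_im]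
  rw [hre, him, hA, hB]
  have : c * B * θ * (c * B * θ) + (0 - c * A * θ) * (0 - c * A * θ) = (c * θ) * ((c * θ) * (A^2+B^2)) := by ring
  rw [this, show c * B * θ = (c * θ) * B by ring, mul_div_mul_left _ _ (by positivity)]

theorem second_order_real_part_beta_one
    {Y : Type*} [MeasurableSpace Y] (μ : Measure Y) [IsProbabilityMeasure μ]
    (φ : Y → ℕ) (hφmeas : Measurable φ) (hφpos : ∀ y, 1 ≤ φ y)
    (c : ℝ) (hc : 0 < c) (q : ℝ) (hq1 : 1 < q) (hq2 : q < 2) (H : ℕ → ℝ)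
    (hH : ∃ K : ℝ, ∀ n : ℕ, 1 ≤ n → |H n| ≤ K * (n : ℝ) ^ (-q))
    (htail : ∀ n : ℕ, 1 ≤ n → (μ {y | n < φ y}).toReal = c * ((n : ℝ)⁻¹ + H n))
    (H₁ : ℝ → ℝ)
    (hH₁def : ∀ x : ℝ, (x < 1 → H₁ x = 1 / c) ∧
      (1 ≤ x → H₁ x = (1 - (μ {y | (φ y : ℝ) ≤ x}).toReal) / c - 1 / x))
    (hH₁int : IntegrableOn H₁ (Set.Ioi 0))
    (Icos : ℝ)
    (hIcos : Tendsto (fun M : ℝ => ∫ σ in (1 : ℝ)..M, Real.cos σ / σ)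
      atTop (𝓝 Icos))
    (cH : ℝ)
    (hcH : cH = (∫ σ in (0 : ℝ)..1, (Real.cos σ - 1) / σ) + Icos
        + ∫ x in Set.Ioi (0 : ℝ), H₁ x)
    (lam : ℝ → ℂ)
    (hlam : ∀ θ : ℝ, lam θ = ∫ y, Complex.exp (Complex.I * θ * (φ y : ℝ)) ∂μ) :
    ∃ K ε : ℝ, 0 < K ∧ 0 < ε ∧ ∀ θ : ℝ, 0 < θ → θ < ε →
      |((1 - lam θ)⁻¹).re
          - (c⁻¹ * (Real.pi / 2) / (θ * (Real.log (1 / θ)) ^ 2)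
             - c⁻¹ * cH * Real.pi / (θ * (Real.log (1 / θ)) ^ 3))|
        ≤ K / (θ * (Real.log (1 / θ)) ^ 4) := by
  obtain ⟨K, hK⟩ := hH
  have hφ' : Measurable (fun y => (φ y : ℝ)) := measurable_from_top.comp hφmeas
  have h0 : ∀ x : ℝ, 0 < x → x < 1 → (μ {y | x < (φ y : ℝ)}).toReal = c * H₁ x := by
    intro x _ hx1
    have : {y | x < (φ y : ℝ)} = Set.univ := by
      ext y
      have : (1:ℝ) ≤ φ y := by exact_mod_cast hφpos y
      simp only [Set.mem_ofPred_eq, Set.mem_univ, iff_true]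
      linarith
    rw [this, (hH₁def x).1 hx1, measure_univ]
    field_simp
    rfl
  have h1 : ∀ x : ℝ, 1 ≤ x → (μ {y | x < (φ y : ℝ)}).toReal = c * (H₁ x + 1 / x) := by
    intro x hx1
    have hs : {y | x < (φ y : ℝ)} = {y | (φ y : ℝ) ≤ x}ᶜ := by
      ext y; simp
    have := probReal_compl_eq_one_sub (μ := μ) (measurableSet_le hφ' (measurable_const (a := x)))
    rw [measureReal_def, measureReal_def] at this
    rw [hs, (hH₁def x).2 hx1, this]
    field_simp
    ring
  have hb : ∀ x : ℝ, 1 ≤ x → |H₁ x| ≤ (2 + K * 2^q) * x ^ (-q) := by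
    intro x hx
    have e := h1 x hx
    have hs : {y | x < (φ y : ℝ)} = {y | ⌊x⌋₊ < φ y} := by
      ext y
      simp only [Set.mem_ofPred_eq]
      exact (Nat.floor_lt (by linarith)).symm
    rw [hs, htail _ ((Nat.one_le_floor_iff x).2 hx)] at e
    have e2 := mul_left_cancel₀ hc.ne' e
    have e3 : H₁ x = ((⌊x⌋₊ : ℝ)⁻¹ + H ⌊x⌋₊) - 1 / x := by linarith
    rw [e3]
    exact H1_bound q hq1 hq2 H K hK x hx
  have hw := H1_weight q _ hq1 H₁ hH₁int hb
  obtain ⟨W, hW⟩ : ∃ W, W = ∫ x in Set.Ioi (0:ℝ), x ^ ((q-1)/2) * |H₁ x| := ⟨_, rfl⟩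
  have hW0 : 0 ≤ W := by
    rw [hW]
    refine setIntegral_nonneg measurableSet_Ioi fun x hx => ?_
    exact mul_nonneg (Real.rpow_nonneg (le_of_lt hx) _) (abs_nonneg _)
  obtain ⟨δ, hδ⟩ : ∃ δ, δ = (q-1)/2 := ⟨_, rfl⟩
  have hδ0 : 0 < δ := by rw [hδ]; linarith
  have hδ1 : δ ≤ 1 := by rw [hδ]; linarith
  obtain ⟨D, hD⟩ : ∃ D, D = (2 * W + 2) * (2 / δ^2) := ⟨_, rfl⟩
  have hD0 : 0 < D := by rw [hD]; positivity
  obtain ⟨E, hE⟩ : ∃ E, E = cH^2+2*D+2*D*|cH|+D^2+(2+D)^2 := ⟨_, rfl⟩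
  have hE0 : 0 < E := by rw [hE]; positivity
  refine ⟨4 * (D + 2*E+8*cH^2+4*|cH| * E) / c, Real.exp (-(max 1 (2 * (|cH| + D)))), by positivity, Real.exp_pos _, ?_⟩
  intro θ hθ hθε
  have hLmax : max 1 (2 * (|cH| + D)) < Real.log (1/θ) := by
    have := Real.log_lt_log hθ hθε
    rw [Real.log_exp] at this
    rw [one_div, Real.log_inv]; linarith
  have hL1 : 1 ≤ Real.log (1/θ) := (le_max_left _ _).trans hLmax.le
  have hL2 := (le_max_right _ _).trans hLmax.le
  have hθ1 : θ < 1 := by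
    refine hθε.trans_le ?_
    rw [Real.exp_le_one_iff]
    have := le_max_left 1 (2 * (|cH| + D))
    linarith
  have hθδ : θ ≤ θ ^ δ := by
    calc θ = θ ^ (1:ℝ) := (Real.rpow_one θ).symm
      _ ≤ _ := Real.rpow_le_rpow_of_exponent_ge hθ hθ1.le hδ1
  have hpl := pow_log δ θ hδ0 hθ hθ1
  have hDb : (2 * W + 2) * θ ^ δ ≤ D / (Real.log (1/θ))^2 := by
    rw [hD, mul_div_assoc]
    exact mul_le_mul_of_nonneg_left hpl (by positivity)
  have hd1 : ∀ x : ℝ, HasDerivAt (fun x => θ * x) θ x := fun x => by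
    simpa using (hasDerivAt_id x).const_mul θ
  -- cosine part
  obtain ⟨ic, eA⟩ := assemble μ φ c (fun x => Real.cos (θ * x)) H₁ (by fun_prop)
    (fun x => Real.abs_cos_le_one _) h0 h1 hH₁int _ _
    (scale_lim Real.cos θ _ hθ (cos_lim Icos hIcos θ hθ hθ1))
    (tail_lim μ φ hφmeas (fun x => Real.cos (θ * x)) (fun x => Real.sin (θ * x) / θ) (by fun_prop)
      (fun x => by
        refine ((hd1 x).sin.div_const θ).congr_deriv ?_
        field_simp) (by simp) (1/θ) (fun x => by
        rw [abs_div, abs_of_pos hθ]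
        exact div_le_div_of_nonneg_right (Real.abs_sin_le_one _) hθ.le))
  obtain ⟨_, eB⟩ := assemble μ φ c (fun x => Real.sin (θ * x)) H₁ (by fun_prop)
    (fun x => Real.abs_sin_le_one _) h0 h1 hH₁int _ _
    (scale_lim Real.sin θ _ hθ (sin_lim θ hθ))
    (tail_lim μ φ hφmeas (fun x => Real.sin (θ * x)) (fun x => (1 - Real.cos (θ * x)) / θ) (by fun_prop)
      (fun x => by
        refine (((hd1 x).cos.const_sub 1).div_const θ).congr_deriv ?_
        field_simp) (by simp) (2/θ) (fun x => by
        rw [abs_div, abs_of_pos hθ]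
        refine div_le_div_of_nonneg_right ?_ hθ.le
        rw [abs_le]
        constructor <;> linarith [Real.cos_le_one (θ * x), Real.neg_one_le_cos (θ * x)]))
  rw [hlam, complex_part μ φ hφmeas θ c _ _ hθ hc eA eB]
  refine final_alg c θ _ _ _ cH D hc hθ hD0.le hL1 hL2 ?_ ?_ E hE
  · refine le_trans ?_ hDb
    have b1 := weight_int q H₁ (fun u => Real.cos u - 1) θ 2 hθ hw
      (fun u hu => cos_bd u _ hu (by linarith) (by linarith))
    have b2 := small_int _ 2 θ hθ cos_div_bd
    have e : ∫ x in Set.Ioi (0:ℝ), (Real.cos (θ * x) - 1) * H₁ x =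
        (∫ x in Set.Ioi (0:ℝ), Real.cos (θ * x) * H₁ x) - ∫ x in Set.Ioi (0:ℝ), H₁ x := by
      rw [← integral_sub ic hH₁int]
      congr 1; ext x; ring
    rw [e, ← hW, ← hδ] at b1
    rw [abs_le] at b1 b2 ⊢
    have hp := Real.rpow_nonneg hθ.le δ
    constructor <;> linarith
  · refine le_trans ?_ hDb
    have b1 := weight_int q H₁ (fun u => Real.sin u) θ 1 hθ hw
      (fun u hu => by rw [one_mul]; exact sin_bd u _ hu (by linarith) (by linarith))
    have b2 := small_int _ 1 θ hθ sin_div_bd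
    rw [← hW, ← hδ] at b1
    have := mul_nonneg (Real.rpow_nonneg hθ.le δ) hW0
    rw [abs_le] at b1 b2 ⊢
    have hp := Real.rpow_nonneg hθ.le δ
    constructor <;> linarith
end

section
/- Tail asymptotics for the Liverani–Saussol–Vaienti intermittency map: let α ≥ 1 and β = 1/α ∈ (0,1]. Define f : [0,1) → [0,1) by f(x) = x(1 + 2^α x^α) for x ∈ [0,1/2) and f(x) = 2x − 1 for x ∈ [1/2,1). Let (x_n) be the sequence with x_0 = 1/2 and x_{n+1} the unique point of (0,1/2] satisfying x_{n+1}(1 + 2^α x_{n+1}^α) = x_n (such a point exists and is unique since x ↦ x(1+2^α x^α) is a strictly increasing bijection from [0,1/2] onto [0,1]). Then x_n = (1/2)·β^{β}·n^{−β}·(1 + O(n^{−1} log n)) as n → ∞. Moreover, with Y = [1/2,1) and first return time φ(y) = inf{n ≥ 1 : fⁿ(y) ∈ Y}, one has Leb{y ∈ Y : φ(y) > n} = x_{n−1}/2 for every n ≥ 1, and hence Leb{y ∈ Y : φ(y) > n} = (1/4)·β^{β}·n^{−β} + O(n^{−(β+1)} log n). -/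
open MeasureTheory Filter Topology

lemma LSV_g_mono (α : ℝ) (hα : 1 ≤ α) {a b : ℝ} (ha : 0 ≤ a) (hab : a < b) :
    a * (1 + 2 ^ α * a ^ α) < b * (1 + 2 ^ α * b ^ α) := by
  have h1 : a ^ α ≤ b ^ α := Real.rpow_le_rpow ha hab.le (by linarith)
  have h2 : (0:ℝ) < 2 ^ α := by positivity
  have h3 : 0 ≤ a ^ α := Real.rpow_nonneg ha _
  have h4 : (2:ℝ) ^ α * a ^ α ≤ 2 ^ α * b ^ α := by gcongr
  have h5 : 0 ≤ (2:ℝ) ^ α * a ^ α := by positivity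
  nlinarith

lemma LSV_half (α : ℝ) : (1/2:ℝ) * (1 + 2 ^ α * (1/2) ^ α) = 1 := by
  rw [← Real.mul_rpow (by norm_num) (by norm_num)]; norm_num

lemma LSV_set (α : ℝ) (hα : 1 ≤ α)
    (f : ℝ → ℝ)
    (hf : ∀ x : ℝ, f x = if x < 1 / 2 then x * (1 + 2 ^ α * x ^ α) else 2 * x - 1)
    (x : ℕ → ℝ) (hx0 : x 0 = 1 / 2)
    (hx : ∀ n : ℕ, x (n + 1) ∈ Set.Ioc (0 : ℝ) (1 / 2) ∧
      x (n + 1) * (1 + 2 ^ α * x (n + 1) ^ α) = x n)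
    (φ : ℝ → ℕ)
    (hφ : ∀ y : ℝ, φ y = sInf {n : ℕ | 1 ≤ n ∧ f^[n] y ∈ Set.Ico (1 / 2 : ℝ) 1}) (m : ℕ) :
    {y : ℝ | y ∈ Set.Ico (1 / 2 : ℝ) 1 ∧ m + 1 < φ y} = Set.Ioo (1/2) ((1 + x m) / 2) := by
  have hpos : ∀ n, 0 < x n := by
    intro n; cases n with
    | zero => rw [hx0]; norm_num
    | succ n => exact (hx n).1.1
  have hle : ∀ n, x n ≤ 1/2 := by
    intro n; cases n with
    | zero => rw [hx0]
    | succ n => exact (hx n).1.2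
  have hA : ∀ k z, 0 < z → z < x k → ∀ j ≤ k, f^[j] z < 1/2 := by
    intro k
    induction k with
    | zero =>
      intro z h0 h1 j hj
      obtain rfl : j = 0 := by omega
      rw [hx0] at h1; simpa using h1
    | succ k ih =>
      intro z h0 h1 j hj
      have hz : z < 1/2 := lt_of_lt_of_le h1 (hle _)
      cases j with
      | zero => simpa using hz
      | succ j =>
        rw [Function.iterate_succ_apply]
        have hfz : f z = z * (1 + 2 ^ α * z ^ α) := by rw [hf, if_pos hz]
        apply ih _ _ _ j (by omega)
        · rw [hfz]; positivity
        · rw [hfz, ← (hx k).2]; exact LSV_g_mono α hα h0.le h1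
  have hB : ∀ k z, x k ≤ z → z < 1 → ∃ j ≤ k, f^[j] z ∈ Set.Ico (1/2:ℝ) 1 := by
    intro k
    induction k with
    | zero =>
      intro z h0 h1
      exact ⟨0, le_rfl, by simpa [hx0] using h0, by simpa using h1⟩
    | succ k ih =>
      intro z h0 h1
      by_cases hz : z < 1/2
      · have hfz : f z = z * (1 + 2 ^ α * z ^ α) := by rw [hf, if_pos hz]
        have hz0 := (hpos (k+1)).trans_le h0
        obtain ⟨j, hj, hjm⟩ := ih (f z) (by
          rw [hfz, ← (hx k).2]
          rcases h0.eq_or_lt with h | h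
          · rw [h]
          · exact (LSV_g_mono α hα (hpos _).le h).le) (by
          rw [hfz]; exact (LSV_g_mono α hα hz0.le hz).trans_eq (LSV_half α))
        exact ⟨j+1, by omega, by rwa [Function.iterate_succ_apply]⟩
      · exact ⟨0, by omega, by simpa using hz, by simpa using h1⟩
  have hC : ∀ z, 0 < z → ∃ k, x k ≤ z := by
    intro z hz
    by_contra! hcon
    have hc : 0 < z * (2 ^ α * z ^ α) := by positivity
    have hstep : ∀ k : ℕ, x k ≤ 1/2 - k * (z * (2 ^ α * z ^ α)) := by
      intro k
      induction k with
      | zero => simp [hx0]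
      | succ k ih =>
        have h1 := (hx k).2
        have h2 := hcon (k+1)
        have h3 : z ^ α ≤ x (k+1) ^ α := Real.rpow_le_rpow hz.le h2.le (by linarith)
        have h4 : z * (2 ^ α * z ^ α) ≤ x (k+1) * (2 ^ α * x (k+1) ^ α) := by
          have := (hpos (k+1)).le
          gcongr
        push_cast
        linarith
    obtain ⟨k, hk⟩ := exists_nat_gt ((1/2) / (z * (2 ^ α * z ^ α)))
    rw [div_lt_iff₀ hc] at hk
    linarith [hstep k, hpos k]
  have hfy : ∀ y, 1/2 ≤ y → f y = 2 * y - 1 := by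
    intro y hy; rw [hf, if_neg (by linarith)]
  have hf0 : f 0 = 0 := by rw [hf]; norm_num
  have hf0' : ∀ j, f^[j] 0 = 0 := fun j => Function.iterate_fixed hf0 j
  ext y
  simp only [Set.mem_ofPred_eq, Set.mem_Ioo]
  constructor
  · rintro ⟨⟨hy1, hy2⟩, hlt⟩
    rw [hφ] at hlt
    constructor
    · rcases hy1.eq_or_lt with h | h
      · exfalso
        have hne : {n : ℕ | 1 ≤ n ∧ f^[n] y ∈ Set.Ico (1 / 2 : ℝ) 1}.Nonempty := by
          apply Nat.nonempty_of_pos_sInf; omega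
        obtain ⟨n, hn, hn2⟩ := hne
        obtain ⟨n, rfl⟩ : ∃ k, n = k + 1 := ⟨n-1, by omega⟩
        rw [Function.iterate_succ_apply, hfy y hy1, ← h] at hn2
        norm_num [hf0'] at hn2
      · exact h
    · by_contra! hcon
      obtain ⟨j, hj, hjm⟩ := hB m (2*y-1) (by linarith) (by linarith)
      have : sInf {n : ℕ | 1 ≤ n ∧ f^[n] y ∈ Set.Ico (1 / 2 : ℝ) 1} ≤ j + 1 := by
        apply Nat.sInf_le
        refine ⟨by omega, ?_⟩
        rwa [Function.iterate_succ_apply, hfy y hy1]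
      omega
  · rintro ⟨hy1, hy2⟩
    have hy3 : y < 1 := by linarith [hle m]
    refine ⟨⟨hy1.le, hy3⟩, ?_⟩
    rw [hφ]
    obtain ⟨k, hk⟩ := hC (2*y-1) (by linarith)
    obtain ⟨j, hj, hjm⟩ := hB k (2*y-1) hk (by linarith)
    have hne : {n : ℕ | 1 ≤ n ∧ f^[n] y ∈ Set.Ico (1 / 2 : ℝ) 1}.Nonempty :=
      ⟨j+1, by omega, by rwa [Function.iterate_succ_apply, hfy y hy1.le]⟩
    obtain ⟨hs1, hs2⟩ := Nat.sInf_mem hne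
    by_contra! hcon
    obtain ⟨i, hi⟩ : ∃ i, sInf {n : ℕ | 1 ≤ n ∧ f^[n] y ∈ Set.Ico (1 / 2 : ℝ) 1} = i + 1 :=
      ⟨_, (Nat.sub_add_cancel hs1).symm⟩
    rw [hi] at hcon hs2
    rw [Function.iterate_succ_apply, hfy y hy1.le] at hs2
    have := hA m (2*y-1) (by linarith) (by linarith) i (by omega)
    linarith [hs2.1]

/-- One step of the recursion for `u = (2x)^(-α)`. -/
lemma LSV_step (α : ℝ) (hα : 1 ≤ α) (x x' : ℝ) (hx' : 0 < x') (hx'2 : x' ≤ 1/2)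
    (h : x' * (1 + 2 ^ α * x' ^ α) = x) :
    1 ≤ ((2 * x') ^ α)⁻¹ ∧
    ((2 * x') ^ α)⁻¹ ≤ ((2 * x) ^ α)⁻¹ + α ∧
    ((2 * x) ^ α)⁻¹ + 1 / 2 ≤ ((2 * x') ^ α)⁻¹ ∧
    ((2 * x) ^ α)⁻¹ + α - α ^ 2 / ((2 * x') ^ α)⁻¹ ≤ ((2 * x') ^ α)⁻¹ := by
  set t := (2 * x') ^ α with ht
  have ht0 : 0 < t := by positivity
  have ht1 : t ≤ 1 := Real.rpow_le_one (by positivity) (by linarith) (by linarith)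
  have hu1 : 1 ≤ t⁻¹ := (one_le_inv₀ ht0).2 ht1
  have e : (2 * x) ^ α = t * (1 + t) ^ α := by
    rw [← h, ← Real.mul_rpow (by norm_num) hx'.le, ← ht, ← mul_assoc,
      Real.mul_rpow (by positivity) (by positivity)]
  have b1 : 1 + α * t ≤ (1 + t) ^ α := one_add_mul_self_le_rpow_one_add (by linarith) hα
  have b2 : (1 + t) ^ α ≤ Real.exp (α * t) := by
    rw [mul_comm, Real.exp_mul]
    exact Real.rpow_le_rpow (by positivity) (by linarith [Real.add_one_le_exp t]) (by linarith)
  set P := (1 + t) ^ α with hP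
  have hP0 : 0 < P := by positivity
  have hQ1 : 1 - α * t ≤ P⁻¹ := by
    calc 1 - α * t ≤ Real.exp (-(α * t)) := by linarith [Real.add_one_le_exp (-(α * t))]
      _ = (Real.exp (α * t))⁻¹ := Real.exp_neg _
      _ ≤ P⁻¹ := by gcongr
  have hQ2 : P⁻¹ ≤ (1 + α * t)⁻¹ := by gcongr
  have hat : 0 < α * t := by positivity
  have hQ3 : (1 + α * t)⁻¹ ≤ 1 - α * t + (α * t) ^ 2 := by
    rw [inv_le_iff_one_le_mul₀ (by positivity)]
    nlinarith [pow_pos hat 3]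
  have hQ4 : (1 + α * t)⁻¹ ≤ 1 - t / 2 := by
    rw [inv_le_iff_one_le_mul₀ (by positivity)]
    nlinarith
  have key : ∀ a, t⁻¹ * (a * t) = a := by intro a; field_simp
  have hti : 0 < t⁻¹ := by positivity
  rw [e, mul_inv]
  refine ⟨hu1, ?_, ?_, ?_⟩
  · have := mul_le_mul_of_nonneg_left hQ1 hti.le
    rw [mul_sub, key] at this; linarith
  · have := mul_le_mul_of_nonneg_left (hQ2.trans hQ4) hti.le
    have h2 := key (1/2)
    rw [mul_sub] at this
    have h3 : t⁻¹ * (t/2) = 1/2 := by rw [← h2]; ring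
    linarith
  · have := mul_le_mul_of_nonneg_left (hQ2.trans hQ3) hti.le
    have h3 : t⁻¹ * (1 - α * t + (α * t) ^ 2) = t⁻¹ - α + α ^ 2 / t⁻¹ := by
      field_simp
    linarith

lemma LSV_u (α : ℝ) (hα : 1 ≤ α) (x : ℕ → ℝ) (hx0 : x 0 = 1 / 2)
    (hx : ∀ n : ℕ, x (n + 1) ∈ Set.Ioc (0 : ℝ) (1 / 2) ∧
      x (n + 1) * (1 + 2 ^ α * x (n + 1) ^ α) = x n) (n : ℕ) :
    ((2 * x n) ^ α)⁻¹ ≤ 1 + α * n ∧ 1 + (n:ℝ) / 2 ≤ ((2 * x n) ^ α)⁻¹ ∧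
    α * n - 2 * α ^ 2 * (harmonic n : ℝ) ≤ ((2 * x n) ^ α)⁻¹ := by
  induction n with
  | zero => simp [hx0]
  | succ n ih =>
    obtain ⟨h1, h2, h3⟩ := ih
    obtain ⟨s1, s2, s3, s4⟩ := LSV_step α hα _ _ (hx n).1.1 (hx n).1.2 (hx n).2
    have hn : (0:ℝ) ≤ n := n.cast_nonneg
    rw [harmonic_succ]
    push_cast
    refine ⟨by linarith, by linarith, ?_⟩
    have : α ^ 2 / ((2 * x (n + 1)) ^ α)⁻¹ ≤ α ^ 2 / (((n:ℝ) + 1) / 2) := by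
      apply div_le_div_of_nonneg_left (by positivity) (by positivity)
      linarith
    have e : α ^ 2 / (((n:ℝ) + 1) / 2) = 2 * α ^ 2 * ((n:ℝ) + 1)⁻¹ := by field_simp
    linarith

lemma LSV_rpow (β s c : ℝ) (hβ0 : 0 < β) (hβ1 : β ≤ 1) (hc : 0 < c) (hc1 : c ≤ 1) (hs : c ≤ s) :
    |s ^ (-β) - 1| ≤ c⁻¹ * |s - 1| := by
  have hs0 : 0 < s := hc.trans_le hs
  have h1 : |1 - s ^ β| ≤ |s - 1| := by
    rcases le_total s 1 with h | h
    · have a1 : s ≤ s ^ β := by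
        simpa using Real.rpow_le_rpow_of_exponent_ge hs0 h hβ1
      have a2 : s ^ β ≤ 1 := Real.rpow_le_one hs0.le h hβ0.le
      rw [abs_of_nonneg (by linarith), abs_of_nonpos (by linarith)]; linarith
    · have a1 : s ^ β ≤ s := by
        simpa using Real.rpow_le_rpow_of_exponent_le h hβ1
      have a2 : 1 ≤ s ^ β := Real.one_le_rpow h hβ0.le
      rw [abs_of_nonpos (by linarith), abs_of_nonneg (by linarith)]; linarith
  have h2 : c ≤ s ^ β := by
    calc c ≤ c ^ β := by simpa using Real.rpow_le_rpow_of_exponent_ge hc hc1 hβ1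
      _ ≤ s ^ β := Real.rpow_le_rpow hc.le hs hβ0.le
  have h3 : 0 < s ^ β := by positivity
  have e : s ^ (-β) - 1 = (s ^ β)⁻¹ * (1 - s ^ β) := by
    rw [Real.rpow_neg hs0.le]; field_simp
  rw [e, abs_mul, abs_of_pos (by positivity : 0 < (s ^ β)⁻¹)]
  gcongr

lemma LSV_x (α : ℝ) (hα : 1 ≤ α) (β : ℝ) (hβ : β = 1 / α) (x : ℕ → ℝ) (hx0 : x 0 = 1 / 2)
    (hx : ∀ n : ℕ, x (n + 1) ∈ Set.Ioc (0 : ℝ) (1 / 2) ∧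
      x (n + 1) * (1 + 2 ^ α * x (n + 1) ^ α) = x n) (n : ℕ) (hn : 2 ≤ n) :
    |x n - 1 / 2 * β ^ β * (n : ℝ) ^ (-β)|
        ≤ (2 + 6 * α ^ 2) * (n : ℝ) ^ (-β) * (Real.log n / n) := by
  obtain ⟨h1, h2, h3⟩ := LSV_u α hα x hx0 hx n
  have hxn : 0 < x n := by
    cases n with
    | zero => omega
    | succ n => exact (hx n).1.1
  have hα0 : 0 < α := by linarith
  have hβ0 : 0 < β := by rw [hβ]; positivity
  have hβ1 : β ≤ 1 := by rw [hβ, div_le_one hα0]; exact hα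
  have hn2 : (2:ℝ) ≤ n := by exact_mod_cast hn
  have hn0 : (0:ℝ) < n := by linarith
  have hL : 1/2 ≤ Real.log n := by
    have : Real.log 2 ≤ Real.log n := Real.log_le_log (by norm_num) hn2
    linarith [Real.log_two_gt_d9]
  have hH := harmonic_le_one_add_log n
  set u := ((2 * x n) ^ α)⁻¹ with hu
  have hu0 : 0 < u := by positivity
  have hxu : x n = 1/2 * u ^ (-β) := by
    rw [hu, ← Real.rpow_neg (by positivity), ← Real.rpow_mul (by positivity)]
    have : -α * -β = 1 := by rw [hβ]; field_simp
    rw [this, Real.rpow_one]; ring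
  have hdiff : |u - α * n| ≤ (2 + 6 * α ^ 2) * Real.log n := by
    have hα2 : 0 < α ^ 2 := by positivity
    rw [abs_le]
    constructor
    · nlinarith
    · nlinarith
  set s := u / (α * n) with hs
  have hus : u = α * n * s := by rw [hs]; field_simp
  have hsl : (2 * α)⁻¹ ≤ s := by
    rw [hs, le_div_iff₀ (by positivity)]
    have : (2 * α)⁻¹ * (α * n) = n / 2 := by field_simp
    linarith
  have hs0 : 0 < s := by positivity
  have hR := LSV_rpow β s (2*α)⁻¹ hβ0 hβ1 (by positivity) (inv_le_one_of_one_le₀ (by linarith)) hsl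
  have hab : α ^ (-β) = β ^ β := by
    rw [Real.rpow_neg hα0.le, ← Real.inv_rpow hα0.le, hβ, one_div]
  have hbb : β ^ β ≤ 1 := Real.rpow_le_one hβ0.le hβ1 hβ0.le
  have hbb0 : 0 < β ^ β := by positivity
  have hnn0 : 0 < (n:ℝ) ^ (-β) := by positivity
  have hsd : |s - 1| ≤ (2 + 6 * α ^ 2) * Real.log n / (α * n) := by
    have : s - 1 = (u - α * n) / (α * n) := by rw [hs]; field_simp
    rw [this, abs_div, abs_of_pos (by positivity : 0 < α * n)]
    gcongr
  have e : x n - 1 / 2 * β ^ β * (n : ℝ) ^ (-β)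
      = (1/2 * β ^ β * (n : ℝ) ^ (-β)) * (s ^ (-β) - 1) := by
    rw [hxu, hus, Real.mul_rpow (by positivity) hs0.le, Real.mul_rpow hα0.le hn0.le, hab]
    ring
  rw [e, abs_mul, abs_of_pos (by positivity)]
  calc (1/2 * β ^ β * (n : ℝ) ^ (-β)) * |s ^ (-β) - 1|
      ≤ (1/2 * 1 * (n : ℝ) ^ (-β)) * ((2*α)⁻¹⁻¹ * ((2 + 6 * α ^ 2) * Real.log n / (α * n))) := by
        gcongr
        exact hR.trans (by gcongr)
    _ = _ := by field_simp

lemma LSV_incr (α : ℝ) (hα : 1 ≤ α) (β : ℝ) (hβ : β = 1 / α) (x : ℕ → ℝ) (hx0 : x 0 = 1 / 2)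
    (hx : ∀ n : ℕ, x (n + 1) ∈ Set.Ioc (0 : ℝ) (1 / 2) ∧
      x (n + 1) * (1 + 2 ^ α * x (n + 1) ^ α) = x n) (m : ℕ) :
    |x m - x (m + 1)| ≤ 2 * ((m + 1 : ℕ) : ℝ) ^ (-(β + 1)) := by
  obtain ⟨h1, h2, h3⟩ := LSV_u α hα x hx0 hx (m+1)
  obtain ⟨⟨p, q⟩, r⟩ := hx m
  have hα0 : 0 < α := by linarith
  have hβ0 : 0 < β := by rw [hβ]; positivity
  have hβ1 : β ≤ 1 := by rw [hβ, div_le_one hα0]; exact hα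
  have hN : (0:ℝ) < ((m+1:ℕ):ℝ) := by positivity
  set N : ℝ := ((m+1:ℕ):ℝ)
  set u := ((2 * x (m+1)) ^ α)⁻¹ with hu
  have hu0 : 0 < u := by positivity
  have hxu : x (m+1) = 1/2 * u ^ (-β) := by
    rw [hu, ← Real.rpow_neg (by positivity), ← Real.rpow_mul (by positivity)]
    have : -α * -β = 1 := by rw [hβ]; field_simp
    rw [this, Real.rpow_one]; ring
  have e : x m - x (m+1) = 1/2 * u ^ (-(β+1)) := by
    have : x m - x (m+1) = x (m+1) * u⁻¹ := by
      rw [hu, inv_inv, Real.mul_rpow (by norm_num) p.le]; linarith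
    rw [this, hxu, neg_add, Real.rpow_add hu0, Real.rpow_neg_one]; ring
  rw [e, abs_of_pos (by positivity)]
  have hb : u ^ (-(β+1)) ≤ (N/2) ^ (-(β+1)) :=
    Real.rpow_le_rpow_of_nonpos (by positivity) (by linarith) (by linarith)
  have hc : (N/2) ^ (-(β+1)) = N ^ (-(β+1)) * 2 ^ (β+1) := by
    rw [Real.div_rpow hN.le (by norm_num), Real.rpow_neg (by norm_num : (0:ℝ) ≤ 2)]
    field_simp
  have hd : (2:ℝ) ^ (β+1) ≤ 4 := by
    calc (2:ℝ) ^ (β+1) ≤ 2 ^ (2:ℝ) :=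
          Real.rpow_le_rpow_of_exponent_le (by norm_num) (by linarith)
      _ = 4 := by norm_num
  have he : 0 < N ^ (-(β+1)) := by positivity
  nlinarith

theorem LSV_tail_asymptotics
    (α : ℝ) (hα : 1 ≤ α) (β : ℝ) (hβ : β = 1 / α)
    (f : ℝ → ℝ)
    (hf : ∀ x : ℝ, f x = if x < 1 / 2 then x * (1 + 2 ^ α * x ^ α) else 2 * x - 1)
    (x : ℕ → ℝ) (hx0 : x 0 = 1 / 2)
    (hx : ∀ n : ℕ, x (n + 1) ∈ Set.Ioc (0 : ℝ) (1 / 2) ∧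
      x (n + 1) * (1 + 2 ^ α * x (n + 1) ^ α) = x n)
    (φ : ℝ → ℕ)
    (hφ : ∀ y : ℝ, φ y = sInf {n : ℕ | 1 ≤ n ∧ f^[n] y ∈ Set.Ico (1 / 2 : ℝ) 1}) :
    (∃ K : ℝ, ∀ n : ℕ, 2 ≤ n →
      |x n - 1 / 2 * β ^ β * (n : ℝ) ^ (-β)|
        ≤ K * (n : ℝ) ^ (-β) * (Real.log n / n)) ∧
    (∀ n : ℕ, 1 ≤ n →
      volume {y : ℝ | y ∈ Set.Ico (1 / 2 : ℝ) 1 ∧ n < φ y}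
        = ENNReal.ofReal (x (n - 1) / 2)) ∧
    (∃ K' : ℝ, ∀ n : ℕ, 2 ≤ n →
      |(volume {y : ℝ | y ∈ Set.Ico (1 / 2 : ℝ) 1 ∧ n < φ y}).toReal
          - 1 / 4 * β ^ β * (n : ℝ) ^ (-β)|
        ≤ K' * (n : ℝ) ^ (-(β + 1)) * Real.log n) := by
  have hvol : ∀ n : ℕ, 1 ≤ n →
      volume {y : ℝ | y ∈ Set.Ico (1 / 2 : ℝ) 1 ∧ n < φ y}
        = ENNReal.ofReal (x (n - 1) / 2) := by
    intro n hn
    obtain ⟨m, rfl⟩ : ∃ m, n = m + 1 := ⟨n - 1, by omega⟩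
    rw [LSV_set α hα f hf x hx0 hx φ hφ m, Real.volume_Ioo]
    congr 1
    rw [Nat.add_sub_cancel]; ring
  refine ⟨⟨_, LSV_x α hα β hβ x hx0 hx⟩, hvol, ⟨2 + (2 + 6 * α ^ 2), ?_⟩⟩
  intro n hn
  have hX := LSV_x α hα β hβ x hx0 hx n hn
  rw [hvol n (by omega)]
  obtain ⟨m, rfl⟩ : ∃ m, n = m + 1 := ⟨n - 1, by omega⟩
  have hI := LSV_incr α hα β hβ x hx0 hx m
  have hxm : 0 < x m := by
    cases m with
    | zero => rw [hx0]; norm_num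
    | succ m => exact (hx m).1.1
  rw [Nat.add_sub_cancel, ENNReal.toReal_ofReal (by positivity)]
  have hn2 : (2:ℝ) ≤ ((m+1:ℕ):ℝ) := by exact_mod_cast hn
  set N : ℝ := ((m+1:ℕ):ℝ)
  have hN0 : 0 < N := by linarith
  have hL : 1/2 ≤ Real.log N := by
    have : Real.log 2 ≤ Real.log N := Real.log_le_log (by norm_num) hn2
    linarith [Real.log_two_gt_d9]
  have hp : 0 < N ^ (-(β+1)) := by positivity
  have e1 : (2 + 6 * α ^ 2) * N ^ (-β) * (Real.log N / N)
      = (2 + 6 * α ^ 2) * (N ^ (-(β+1)) * Real.log N) := by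
    rw [neg_add, Real.rpow_add hN0, Real.rpow_neg_one]; ring
  rw [e1] at hX
  have hpl : N ^ (-(β+1)) * (1/2) ≤ N ^ (-(β+1)) * Real.log N := by gcongr
  have hpos : 0 ≤ (2 + 6 * α ^ 2) * (N ^ (-(β+1)) * Real.log N) := by positivity
  rw [abs_le] at hX hI ⊢
  constructor <;> linarith [hX.1, hX.2, hI.1, hI.2]
end

section
/- No nontrivial eigenfunctions for the twisted cocycle equation over a first return map of a topologically mixing system: let X be a topological space and f : X → X topologically mixing, i.e. for all nonempty open sets U, V ⊆ X there exists N ≥ 1 such that fⁿ(U) ∩ V ≠ ∅ for all n ≥ N. Let Y ⊆ X, suppose φ : Y → {1,2,3,…} satisfies φ(y) = min{n ≥ 1 : fⁿ(y) ∈ Y} for every y ∈ Y (in particular {n ≥ 1 : fⁿ(y) ∈ Y} is nonempty), and let F : Y → Y be given by F(y) = f^{φ(y)}(y). Let θ ∈ ℝ and v : Y → ℂ satisfy v(F(y)) = e^{iθφ(y)} v(y) for every y ∈ Y. If there exist a nonempty open subset U of X with U ⊆ Y and a constant c ≠ 0 such that v(y) = c for all y ∈ U, then e^{iθ} = 1.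 -/
open Filter Topology

theorem no_nontrivial_twisted_eigenfunctions
    {X : Type*} [TopologicalSpace X] (f : X → X)
    (hmix : ∀ U V : Set X, IsOpen U → U.Nonempty → IsOpen V → V.Nonempty →
      ∃ N : ℕ, ∀ n : ℕ, N ≤ n → (f^[n] '' U ∩ V).Nonempty)
    (Y : Set X) (φ : X → ℕ)
    (hφ_pos : ∀ y ∈ Y, 1 ≤ φ y)
    (hφ_ret : ∀ y ∈ Y, f^[φ y] y ∈ Y)
    (hφ_min : ∀ y ∈ Y, ∀ m : ℕ, 1 ≤ m → f^[m] y ∈ Y → φ y ≤ m)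
    (θ : ℝ) (v : X → ℂ)
    (hv : ∀ y ∈ Y, v (f^[φ y] y) = Complex.exp (Complex.I * θ * (φ y : ℝ)) * v y)
    (U : Set X) (hUopen : IsOpen U) (hUne : U.Nonempty) (hUY : U ⊆ Y)
    (c : ℂ) (hc : c ≠ 0) (hvc : ∀ y ∈ U, v y = c) :
    Complex.exp (Complex.I * θ) = 1 := by
  have key : ∀ n : ℕ, ∀ y ∈ Y, f^[n] y ∈ Y →
      v (f^[n] y) = Complex.exp (Complex.I * θ) ^ n * v y := by
    intro n
    induction n using Nat.strong_induction_on with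
    | _ n ih =>
      intro y hy hn
      rcases Nat.eq_zero_or_pos n with h0 | h0
      · subst h0
        simp
      · have hle := hφ_min y hy n h0 hn
        have hpos := hφ_pos y hy
        have hsplit : f^[n] y = f^[n - φ y] (f^[φ y] y) := by
          rw [← Function.iterate_add_apply, Nat.sub_add_cancel hle]
        have h1 := ih (n - φ y) (by omega) (f^[φ y] y) (hφ_ret y hy) (hsplit ▸ hn)
        have he : Complex.exp (Complex.I * θ * (φ y : ℝ)) = Complex.exp (Complex.I * θ) ^ φ y := by
          rw [← Complex.exp_nat_mul]
          congr 1
          push_cast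
          ring
        rw [hsplit, h1, hv y hy, he, ← mul_assoc, ← pow_add, Nat.sub_add_cancel hle]
  obtain ⟨N, hN⟩ := hmix U U hUopen hUne hUopen hUne
  have hpow : ∀ n, N ≤ n → Complex.exp (Complex.I * θ) ^ n = 1 := by
    intro n hn
    obtain ⟨z, ⟨y, hy, rfl⟩, hz⟩ := hN n hn
    have h := key n y (hUY hy) (hUY hz)
    rw [hvc _ hz, hvc _ hy] at h
    exact mul_right_cancel₀ hc (by rw [← h, one_mul])
  have h1 := hpow N le_rfl
  have h2 := hpow (N + 1) (Nat.le_succ N)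
  rwa [pow_succ, h1, one_mul] at h2
end
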